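/- arXiv:0705.0457 — 5 statements merged into one kernel-verified Lean document; each statement's English description precedes it below -/
import Mathlib

section
/- For every pair of consecutive primes p < q with q > 37, one has 1000·q < 1144·p (equivalently, q/p < 1.144). -/
/-- `p` and `q` are consecutive primes: `q` is the smallest prime greater than `p`. -/
def ConsecutivePrimes (p q : ℕ) : Prop :=
  p.Prime ∧ q.Prime ∧ p < q ∧ ∀ r : ℕ, r.Prime → p < r → q ≤ r

/-- Modular exponentiation by repeated squaring, structurally recursive on fuel. -/
def powMod (p : ℕ) : ℕ → ℕ → ℕ → ℕ
  | 0, _, _ => 1 % p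
  | fuel + 1, a, n =>
    bif n % 2 == 1 then a * powMod p fuel (a * a % p) (n / 2) % p
    else powMod p fuel (a * a % p) (n / 2)

lemma powMod_eq (p fuel a n : ℕ) (h : n < 2 ^ fuel) : powMod p fuel a n = a ^ n % p := by
  induction fuel generalizing a n with
  | zero =>
    have : n = 0 := by simpa using h
    subst this; simp [powMod]
  | succ k ih =>
    have hk : n / 2 < 2 ^ k := by rw [pow_succ] at h; omega
    have key : (a * a % p) ^ (n / 2) % p = a ^ (2 * (n / 2)) % p := by
      rw [← Nat.pow_mod, pow_mul, sq]
    rw [powMod, ih _ _ hk, key]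
    rcases Nat.mod_two_eq_zero_or_one n with h0 | h1
    · have : 2 * (n / 2) = n := by omega
      simp [h0, this]
    · have h2 : n = 2 * (n / 2) + 1 := by omega
      simp only [h1, beq_self_eq_true, cond_true]
      conv_rhs => rw [h2, pow_succ, mul_comm]
      simp [Nat.mul_mod]

/-- The small primes allowed to divide `p - 1` in our certificates. -/
def smallPrimes : List ℕ := [2, 3, 5, 7, 11, 13, 23, 29, 37]

/-- Lucas certificate: `p - 1` is smooth and `a` is a primitive root. -/
def lucasOK (p a : ℕ) : Bool :=
  Nat.ble 2 p && Nat.blt p (2 ^ 41) && (smallPrimes.prod ^ 40 % (p - 1) == 0) &&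
    (powMod p 41 a (p - 1) == 1) &&
    smallPrimes.all fun l => !((p - 1) % l == 0) || !(powMod p 41 a ((p - 1) / l) == 1)

lemma prime_of_lucasOK {p a : ℕ} (h : lucasOK p a = true) : p.Prime := by
  simp only [lucasOK, Bool.and_eq_true, Nat.ble_eq, Nat.blt_eq, beq_iff_eq, List.all_eq_true,
    Bool.or_eq_true, Bool.not_eq_true', beq_eq_false_iff_ne] at h
  obtain ⟨⟨⟨⟨h2, hlt⟩, hsm⟩, hpow⟩, hall⟩ := h
  have cast_iff : ∀ n : ℕ, n < 2 ^ 41 → (((a : ZMod p) ^ n = 1) ↔ powMod p 41 a n = 1) := by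
    intro n hn
    rw [powMod_eq _ _ _ _ hn]
    have : ((a : ZMod p) ^ n = 1) ↔ (((a ^ n : ℕ) : ZMod p) = ((1 : ℕ) : ZMod p)) := by
      push_cast; rfl
    rw [this, ZMod.natCast_eq_natCast_iff', Nat.mod_eq_of_lt (show 1 < p by omega)]
  refine lucas_primality p (a : ZMod p) ((cast_iff _ (by omega)).2 hpow) ?_
  intro q hq hqd hq1
  have hd : q ∣ smallPrimes.prod := hq.dvd_of_dvd_pow (hqd.trans (Nat.dvd_of_mod_eq_zero hsm))
  have hmem : q ∈ smallPrimes := by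
    obtain ⟨l, hl, hql⟩ := (hq.prime.dvd_prod_iff).1 hd
    have hlp : l.Prime := by
      simp only [smallPrimes, List.mem_cons, List.not_mem_nil, or_false] at hl
      rcases hl with rfl | rfl | rfl | rfl | rfl | rfl | rfl | rfl | rfl <;> norm_num
    rwa [(Nat.prime_dvd_prime_iff_eq hq hlp).1 hql]
  have hle : (p - 1) / q < 2 ^ 41 := lt_of_le_of_lt (Nat.div_le_self _ _) (by omega)
  rcases hall q hmem with h | h
  · exact h (Nat.mod_eq_zero_of_dvd hqd)
  · exact h ((cast_iff _ hle).1 hq1)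

/-- A chain of certified primes with ratios below `1.144`, starting above `r`, exceeding `10^12`. -/
def chainOK : ℕ → List (ℕ × ℕ) → Bool
  | r, [] => Nat.blt (10 ^ 12) r
  | r, c :: l => lucasOK c.1 c.2 && Nat.blt (1000 * c.1) (1144 * r) && chainOK c.1 l

lemma chain_bound (p q : ℕ) (hpq : ConsecutivePrimes p q) (hp : p ≤ 10 ^ 12) :
    ∀ (l : List (ℕ × ℕ)) (r : ℕ), chainOK r l = true → r ≤ p → 1000 * q < 1144 * p := by
  intro l
  induction l with
  | nil =>
    intro r h hr
    simp only [chainOK, Nat.blt_eq] at h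
    omega
  | cons c l ih =>
    intro r h hr
    simp only [chainOK, Bool.and_eq_true, Nat.blt_eq] at h
    obtain ⟨⟨h1, h2⟩, h3⟩ := h
    by_cases hc : c.1 ≤ p
    · exact ih c.1 h3 hc
    · have := hpq.2.2.2 c.1 (prime_of_lucasOK h1) (by omega)
      omega

/-- The certified chain: pairs of a prime and a primitive root. -/
def chain : List (ℕ × ℕ) :=
  [(41, 6), (43, 3), (47, 5), (53, 2), (59, 2), (67, 2), (73, 5), (79, 3), (89, 3), (101, 2),
   (113, 3), (127, 3), (131, 2), (149, 2), (163, 2), (181, 2), (199, 3), (211, 2), (241, 7),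
   (271, 6), (281, 3), (313, 10), (353, 3), (401, 3), (449, 3), (491, 2), (547, 2), (617, 3),
   (701, 2), (769, 11), (859, 2), (937, 5), (1051, 7), (1201, 11), (1373, 2), (1471, 6), (1621,
   2), (1801, 11), (2029, 2), (2311, 3), (2593, 7), (2917, 5), (3329, 3), (3719, 7), (4201, 11),
   (4801, 7), (5347, 3), (6007, 3), (6761, 3), (7723, 3), (8821, 2), (9901, 2), (11251, 13),
   (12637, 2), (14407, 19), (16381, 2), (18523, 3), (21169, 13), (24001, 14), (27457, 7),
   (30977, 3), (35281, 23), (39937, 5), (45631, 12), (51481, 17), (58321, 11), (66529, 19),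
   (73009, 7), (82811, 2), (93601, 22), (106921, 14), (121501, 2), (138241, 7), (157951, 3),
   (180181, 6), (204751, 3), (232961, 12), (264601, 11), (301841, 3), (342733, 2), (390391, 11),
   (444529, 13), (508033, 10), (576577, 10), (659101, 6), (748801, 29), (851761, 29), (972001,
   22), (1108801, 19), (1267501, 2), (1450021, 2), (1655809, 31), (1892353, 13), (2160001, 11),
   (2460641, 3), (2811073, 5), (3214891, 2), (3667357, 2), (4182751, 3), (4777501, 2), (5465461,
   17), (6240001, 21), (7138561, 7), (8164801, 11), (9335089, 23), (10672201, 13), (12192769,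
   11), (13931191, 12), (15855841, 31), (18125251, 7), (20699713, 5), (23654593, 5), (27056569,
   19), (30900871, 3), (35335873, 5), (40370177, 3), (46137001, 31), (52780729, 23), (60211201,
   13), (68708641, 23), (78486409, 17), (89443927, 3), (102263393, 3), (116795251, 3),
   (133555969, 11), (152252101, 2), (173935081, 7), (198744001, 41), (227363137, 17),
   (259875001, 19), (297297001, 31), (339304681, 29), (387991297, 5), (443704801, 13),
   (507000001, 11), (580008001, 21), (663390001, 22), (758160001, 19), (867328001, 3),
   (992223233, 6), (1133740801, 11), (1294893601, 34), (1478062081, 13), (1690730497, 5),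
   (1929141761, 3), (2205918751, 6), (2519424001, 7), (2880541441, 11), (3294172001, 6),
   (3762281251, 7), (4302592001, 3), (4922165249, 6), (5627343751, 3), (6436209781, 6),
   (7362272737, 5), (8416808401, 31), (9616029697, 5), (10990780417, 31), (12559712257, 5),
   (14355198001, 29), (16418902501, 6), (18776862721, 13), (21475312321, 13), (24557524993, 10),
   (28080000001, 29), (32118177001, 23), (36736860161, 6), (41974732801, 23), (48013922881, 19),
   (54898593751, 6), (62741250001, 19), (71775990001, 37), (82012500001, 14), (93822300001, 17),
   (107332711201, 23), (122716070401, 76), (140332500001, 19), (160540380001, 41),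
   (183474720001, 7), (209873664001, 37), (239840192593, 5), (274207612771, 2), (313632000001,
   7), (358795008001, 7), (410139591751, 14), (469165834801, 7), (536481792001, 19),
   (613674054577, 10), (701662500001, 13), (801613283329, 21), (916722970417, 5),
   (1048517084161, 11)]

lemma chain_ok : chainOK 37 chain = true := by decide +kernel

lemma small_case (p q : ℕ) (hpq : ConsecutivePrimes p q) (hq : q > 37) (hp : p ≤ 10 ^ 12) :
    1000 * q < 1144 * p := by
  refine chain_bound p q hpq hp chain 37 chain_ok ?_
  by_contra h
  have := hpq.2.2.2 37 (by norm_num) (by omega)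
  omega

open ArithmeticFunction in
lemma log_factorial_eq (M : ℕ) :
    Real.log (M.factorial : ℝ) = ∑ n ∈ Finset.Ioc 0 M, vonMangoldt n * ((M / n : ℕ) : ℝ) := by
  rw [← sum_Ioc_mul_zeta_eq_sum, vonMangoldt_mul_zeta]
  induction M with
  | zero => simp
  | succ k ih =>
    rw [Finset.sum_Ioc_succ_top (by omega), ← ih, Nat.factorial_succ, Nat.cast_mul,
      Real.log_mul (by positivity) (by positivity), add_comm]
    simp [log_apply]

open ArithmeticFunction in
lemma log_factorial_div (N d : ℕ) :
    Real.log ((N / d).factorial : ℝ)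
      = ∑ n ∈ Finset.Ioc 0 N, vonMangoldt n * ((N / n / d : ℕ) : ℝ) := by
  rw [log_factorial_eq]
  have hsub : Finset.Ioc 0 (N / d) ⊆ Finset.Ioc 0 N :=
    Finset.Ioc_subset_Ioc_right (Nat.div_le_self _ _)
  rw [← Finset.sum_subset hsub]
  · refine Finset.sum_congr rfl fun n _ => ?_
    rw [Nat.div_div_eq_div_mul, Nat.div_div_eq_div_mul, mul_comm d n]
  · intro n hn hn'
    simp only [Finset.mem_Ioc, not_and, not_le] at hn hn'
    have h1 : N / n / d = 0 := by
      rw [Nat.div_div_eq_div_mul, mul_comm, ← Nat.div_div_eq_div_mul]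
      exact Nat.div_eq_of_lt (hn' hn.1)
    simp [h1]

open ArithmeticFunction in
lemma psi_div (N k : ℕ) (hk : 0 < k) :
    ∑ n ∈ Finset.Ioc 0 (N / k), vonMangoldt n
      = ∑ n ∈ Finset.Ioc 0 N, vonMangoldt n * (if k ≤ N / n then (1 : ℝ) else 0) := by
  have hsub : Finset.Ioc 0 (N / k) ⊆ Finset.Ioc 0 N :=
    Finset.Ioc_subset_Ioc_right (Nat.div_le_self _ _)
  rw [← Finset.sum_subset hsub]
  · refine Finset.sum_congr rfl fun n hn => ?_
    simp only [Finset.mem_Ioc] at hn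
    rw [if_pos, mul_one]
    rw [Nat.le_div_iff_mul_le hk] at hn
    rw [Nat.le_div_iff_mul_le hn.1, mul_comm]; exact hn.2
  · intro n hn hn'
    simp only [Finset.mem_Ioc, not_and, not_le] at hn hn'
    rw [if_neg, mul_zero]
    intro h
    rw [Nat.le_div_iff_mul_le hn.1, mul_comm] at h
    have := hn' hn.1
    rw [Nat.div_lt_iff_lt_mul hk] at this
    omega

/-- Sylvester's combination of floors. -/
def sylE (m : ℕ) : ℤ :=
  ((m + m / 6 + m / 70 : ℕ) : ℤ) - ((m / 2 + m / 3 + m / 5 + m / 7 + m / 210 : ℕ) : ℤ)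

lemma sylE_mod (m : ℕ) : sylE m = sylE (m % 210) := by
  unfold sylE
  have h2 : m / 2 = 105 * (m / 210) + m % 210 / 2 := by omega
  have h3 : m / 3 = 70 * (m / 210) + m % 210 / 3 := by omega
  have h5 : m / 5 = 42 * (m / 210) + m % 210 / 5 := by omega
  have h6 : m / 6 = 35 * (m / 210) + m % 210 / 6 := by omega
  have h7 : m / 7 = 30 * (m / 210) + m % 210 / 7 := by omega
  have h70 : m / 70 = 3 * (m / 210) + m % 210 / 70 := by omega
  have h1 : m = 210 * (m / 210) + m % 210 := by omega
  have h210 : m % 210 / 210 = 0 := by omega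
  rw [h2, h3, h5, h6, h7, h70, h210]
  push_cast
  omega

/-- The indicator of `k ≤ m`. -/
def ind (k m : ℕ) : ℤ := if k ≤ m then 1 else 0

lemma sylE_range (m : ℕ) : 0 ≤ sylE m ∧ sylE m ≤ 2 := by
  rw [sylE_mod]
  have h : ∀ r < 210, 0 ≤ sylE r ∧ sylE r ≤ 2 := by decide +kernel
  exact h _ (Nat.mod_lt _ (by norm_num))

lemma sylE_lower (m : ℕ) (hm : 1 ≤ m) :
    1 - ind 10 m + ind 11 m - ind 15 m + ind 17 m - ind 21 m + ind 23 m - ind 28 m ≤ sylE m := by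
  by_cases h : m < 210
  · have h' : ∀ r < 210, 1 ≤ r → 1 - ind 10 r + ind 11 r - ind 15 r + ind 17 r - ind 21 r
      + ind 23 r - ind 28 r ≤ sylE r := by decide +kernel
    exact h' m h hm
  · have := (sylE_range m).1
    simp only [ind]
    rw [if_pos, if_pos, if_pos, if_pos, if_pos, if_pos, if_pos] <;> omega

lemma sylE_upper (m : ℕ) (hm : 1 ≤ m) :
    sylE m ≤ 1 + ind 13 m - ind 14 m - ind 15 m + ind 17 m + ind 19 m - ind 20 m + ind 73 m := by
  by_cases h : m < 210
  · have h' : ∀ r < 210, 1 ≤ r → sylE r ≤ 1 + ind 13 r - ind 14 r - ind 15 r + ind 17 r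
      + ind 19 r - ind 20 r + ind 73 r := by decide +kernel
    exact h' m h hm
  · have := (sylE_range m).2
    simp only [ind]
    rw [if_pos, if_pos, if_pos, if_pos, if_pos, if_pos, if_pos] <;> omega

/-- `log ⌊x⌋!`. -/
noncomputable def logFac (x : ℝ) : ℝ := Real.log ((⌊x⌋₊).factorial : ℝ)

/-- Sylvester's combination of log-factorials. -/
noncomputable def sylU (x : ℝ) : ℝ :=
  logFac x + logFac (x / 6) + logFac (x / 70)
    - (logFac (x / 2) + logFac (x / 3) + logFac (x / 5) + logFac (x / 7) + logFac (x / 210))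

open ArithmeticFunction in
lemma logFac_div (x : ℝ) (d : ℕ) :
    logFac (x / d) = ∑ n ∈ Finset.Ioc 0 ⌊x⌋₊, vonMangoldt n * ((⌊x⌋₊ / n / d : ℕ) : ℝ) := by
  rw [logFac, Nat.floor_div_natCast, log_factorial_div]

open ArithmeticFunction in
lemma psi_div_real (x : ℝ) (k : ℕ) (hk : 0 < k) :
    Chebyshev.psi (x / k)
      = ∑ n ∈ Finset.Ioc 0 ⌊x⌋₊, vonMangoldt n * ((ind k (⌊x⌋₊ / n) : ℤ) : ℝ) := by
  rw [Chebyshev.psi, Nat.floor_div_natCast, psi_div _ _ hk]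
  refine Finset.sum_congr rfl fun n _ => ?_
  simp [ind]

open ArithmeticFunction in
lemma sylU_eq (x : ℝ) :
    sylU x = ∑ n ∈ Finset.Ioc 0 ⌊x⌋₊, vonMangoldt n * ((sylE (⌊x⌋₊ / n) : ℤ) : ℝ) := by
  have h1 := logFac_div x 1
  have h2 := logFac_div x 2
  have h3 := logFac_div x 3
  have h5 := logFac_div x 5
  have h6 := logFac_div x 6
  have h7 := logFac_div x 7
  have h70 := logFac_div x 70
  have h210 := logFac_div x 210
  push_cast at h1 h2 h3 h5 h6 h7 h70 h210
  rw [div_one] at h1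
  rw [sylU, h1, h2, h3, h5, h6, h7, h70, h210]
  simp only [← Finset.sum_add_distrib, ← Finset.sum_sub_distrib]
  refine Finset.sum_congr rfl fun n _ => ?_
  simp only [sylE, Nat.div_one, Int.cast_sub, Int.cast_add, Int.cast_natCast, Nat.cast_add]
  ring

open ArithmeticFunction in
lemma psi_upper_rec (x : ℝ) :
    Chebyshev.psi x ≤ sylU x + Chebyshev.psi (x / 10) - Chebyshev.psi (x / 11)
      + Chebyshev.psi (x / 15) - Chebyshev.psi (x / 17) + Chebyshev.psi (x / 21)
      - Chebyshev.psi (x / 23) + Chebyshev.psi (x / 28) := by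
  have h1 := psi_div_real x 10 (by norm_num)
  have h2 := psi_div_real x 11 (by norm_num)
  have h3 := psi_div_real x 15 (by norm_num)
  have h4 := psi_div_real x 17 (by norm_num)
  have h5 := psi_div_real x 21 (by norm_num)
  have h6 := psi_div_real x 23 (by norm_num)
  have h7 := psi_div_real x 28 (by norm_num)
  push_cast at h1 h2 h3 h4 h5 h6 h7
  rw [h1, h2, h3, h4, h5, h6, h7, sylU_eq, Chebyshev.psi]
  simp only [← Finset.sum_add_distrib, ← Finset.sum_sub_distrib]
  refine Finset.sum_le_sum fun n hn => ?_
  simp only [Finset.mem_Ioc] at hn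
  have hE := sylE_lower (⌊x⌋₊ / n) (Nat.div_pos hn.2 hn.1)
  have hE' := (Int.cast_le (R := ℝ)).2 hE
  push_cast at hE'
  have hv : 0 ≤ vonMangoldt n := vonMangoldt_nonneg
  nlinarith [mul_le_mul_of_nonneg_left hE' hv]

open ArithmeticFunction in
lemma psi_lower_rec (x : ℝ) :
    sylU x - Chebyshev.psi (x / 13) + Chebyshev.psi (x / 14)
      + Chebyshev.psi (x / 15) - Chebyshev.psi (x / 17) - Chebyshev.psi (x / 19)
      + Chebyshev.psi (x / 20) - Chebyshev.psi (x / 73) ≤ Chebyshev.psi x := by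
  have h1 := psi_div_real x 13 (by norm_num)
  have h2 := psi_div_real x 14 (by norm_num)
  have h3 := psi_div_real x 15 (by norm_num)
  have h4 := psi_div_real x 17 (by norm_num)
  have h5 := psi_div_real x 19 (by norm_num)
  have h6 := psi_div_real x 20 (by norm_num)
  have h7 := psi_div_real x 73 (by norm_num)
  push_cast at h1 h2 h3 h4 h5 h6 h7
  rw [h1, h2, h3, h4, h5, h6, h7, sylU_eq, Chebyshev.psi]
  simp only [← Finset.sum_add_distrib, ← Finset.sum_sub_distrib]
  refine Finset.sum_le_sum fun n hn => ?_
  simp only [Finset.mem_Ioc] at hn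
  have hE := sylE_upper (⌊x⌋₊ / n) (Nat.div_pos hn.2 hn.1)
  have hE' := (Int.cast_le (R := ℝ)).2 hE
  push_cast at hE'
  have hv : 0 ≤ vonMangoldt n := vonMangoldt_nonneg
  nlinarith [mul_le_mul_of_nonneg_left hE' hv]

lemma log_factorial_bounds (m : ℕ) (hm : 1 ≤ m) :
    (m : ℝ) * Real.log m - m + 1 ≤ Real.log (m.factorial : ℝ) ∧
    Real.log (m.factorial : ℝ) ≤ (m : ℝ) * Real.log m - m + 1 + Real.log m := by
  induction m, hm using Nat.le_induction with
  | base => simp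
  | succ m hm ih =>
    have hm0 : (0 : ℝ) < m := by exact_mod_cast hm
    have hm1 : (0 : ℝ) < (m : ℝ) + 1 := by positivity
    have e1 : Real.log ((m + 1).factorial : ℝ) = Real.log ((m : ℝ) + 1)
        + Real.log (m.factorial : ℝ) := by
      rw [Nat.factorial_succ, Nat.cast_mul, Real.log_mul (by positivity) (by positivity)]
      push_cast; rfl
    have k1 : Real.log ((m : ℝ) + 1) - Real.log m ≤ 1 / m := by
      rw [← Real.log_div hm1.ne' hm0.ne']
      have := Real.log_le_sub_one_of_pos (div_pos hm1 hm0)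
      have h2 : ((m : ℝ) + 1) / m - 1 = 1 / m := by field_simp; ring
      linarith
    have k2 : Real.log (m : ℝ) - Real.log ((m : ℝ) + 1) ≤ - (1 / (m + 1)) := by
      rw [← Real.log_div hm0.ne' hm1.ne']
      have := Real.log_le_sub_one_of_pos (div_pos hm0 hm1)
      have h2 : (m : ℝ) / (m + 1) - 1 = - (1 / (m + 1)) := by field_simp; ring
      linarith
    have k1' : (m : ℝ) * (Real.log ((m : ℝ) + 1) - Real.log m) ≤ 1 := by
      have := mul_le_mul_of_nonneg_left k1 hm0.le
      rwa [mul_one_div_cancel hm0.ne'] at this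
    have k2' : ((m : ℝ) + 1) * (Real.log (m : ℝ) - Real.log ((m : ℝ) + 1)) ≤ -1 := by
      have := mul_le_mul_of_nonneg_left k2 hm1.le
      rwa [mul_neg, mul_one_div_cancel hm1.ne'] at this
    rw [e1]
    push_cast
    obtain ⟨i1, i2⟩ := ih
    constructor <;> nlinarith

lemma logFac_bounds_large (y : ℝ) (hy : 1 ≤ y) :
    y * Real.log y - y + 1 - Real.log y ≤ logFac y ∧
    logFac y ≤ y * Real.log y - y + 1 + Real.log y := by
  have hm : 1 ≤ ⌊y⌋₊ := Nat.le_floor (by simpa using hy)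
  obtain ⟨b1, b2⟩ := log_factorial_bounds ⌊y⌋₊ hm
  rw [← logFac] at b1 b2
  have f1 : (⌊y⌋₊ : ℝ) ≤ y := Nat.floor_le (by linarith)
  have f2 : y < ⌊y⌋₊ + 1 := Nat.lt_floor_add_one y
  have hm1 : (1 : ℝ) ≤ (⌊y⌋₊ : ℝ) := by exact_mod_cast hm
  generalize (⌊y⌋₊ : ℝ) = m at *
  have hm0 : 0 < m := by linarith
  have hy0 : 0 < y := by linarith
  have l1 : m * (Real.log y - Real.log m) ≤ y - m := by
    rw [← Real.log_div hy0.ne' hm0.ne']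
    have := mul_le_mul_of_nonneg_left (Real.log_le_sub_one_of_pos (div_pos hy0 hm0)) hm0.le
    have h2 : m * (y / m - 1) = y - m := by field_simp
    linarith
  have l2 : y * (Real.log m - Real.log y) ≤ m - y := by
    rw [← Real.log_div hm0.ne' hy0.ne']
    have := mul_le_mul_of_nonneg_left (Real.log_le_sub_one_of_pos (div_pos hm0 hy0)) hy0.le
    have h2 : y * (m / y - 1) = m - y := by field_simp
    linarith
  have l3 : 0 ≤ Real.log m := Real.log_nonneg hm1
  have l4 : Real.log m ≤ Real.log y := Real.log_le_log hm0 f1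
  constructor
  · have : (y - m) * Real.log y ≤ 1 * Real.log y :=
      mul_le_mul_of_nonneg_right (by linarith) (by linarith)
    nlinarith
  · have : 0 ≤ (y - m) * Real.log m := mul_nonneg (by linarith) l3
    nlinarith

lemma logFac_bounds (x y : ℝ) (hx : 1 ≤ x) (hy : 0 < y) (hyx : y ≤ x) :
    y * Real.log y - y - Real.log x ≤ logFac y ∧
    logFac y ≤ y * Real.log y - y + 1 + Real.log x := by
  by_cases h : 1 ≤ y
  · obtain ⟨h1, h2⟩ := logFac_bounds_large y h
    have := Real.log_le_log hy hyx
    constructor <;> linarith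
  · push Not at h
    have h0 : logFac y = 0 := by
      rw [logFac, Nat.floor_eq_zero.2 h]; simp
    have hL : 0 ≤ Real.log x := Real.log_nonneg hx
    have h1 : y * Real.log y ≤ 0 := mul_nonpos_of_nonneg_of_nonpos hy.le (Real.log_nonpos hy.le h.le)
    have h2 : y - 1 ≤ y * Real.log y := by
      have := mul_le_mul_of_nonneg_left (Real.one_sub_inv_le_log_of_pos hy) hy.le
      rwa [mul_sub, mul_inv_cancel₀ hy.ne', mul_one] at this
    rw [h0]
    constructor <;> linarith

lemma log_ratio_lower (a k n : ℕ) (h : 2 ^ k ≤ a ^ n) :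
    (k : ℝ) * Real.log 2 ≤ n * Real.log a := by
  rw [← Real.log_pow, ← Real.log_pow]
  exact Real.log_le_log (by positivity) (by exact_mod_cast h)

lemma log_ratio_upper (a k n : ℕ) (ha : 0 < a) (h : a ^ n ≤ 2 ^ k) :
    n * Real.log a ≤ (k : ℝ) * Real.log 2 := by
  rw [← Real.log_pow, ← Real.log_pow]
  exact Real.log_le_log (by positivity) (by exact_mod_cast h)

set_option exponentiation.threshold 1000 in
lemma sylU_bounds (x : ℝ) (hx : 1 ≤ x) :
    97875 / 100000 * x - 16 * √x ≤ sylU x ∧ sylU x ≤ 97885 / 100000 * x + 16 * √x := by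
  have hx0 : 0 < x := by linarith
  have H : ∀ d : ℝ, 1 ≤ d →
      (x / d) * (Real.log x - Real.log d) - x / d - Real.log x ≤ logFac (x / d) ∧
      logFac (x / d) ≤ (x / d) * (Real.log x - Real.log d) - x / d + 1 + Real.log x := by
    intro d hd
    have hd0 : 0 < d := by linarith
    rw [← Real.log_div hx0.ne' hd0.ne']
    exact logFac_bounds x (x / d) hx (by positivity) (div_le_self hx0.le hd)
  have h1 := H 1 (by norm_num)
  have h2 := H 2 (by norm_num)
  have h3 := H 3 (by norm_num)
  have h5 := H 5 (by norm_num)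
  have h6 := H 6 (by norm_num)
  have h7 := H 7 (by norm_num)
  have h70 := H 70 (by norm_num)
  have h210 := H 210 (by norm_num)
  rw [Real.log_one, div_one] at h1
  have e6 : Real.log 6 = Real.log 2 + Real.log 3 := by
    rw [← Real.log_mul (by norm_num) (by norm_num)]; norm_num
  have e70 : Real.log 70 = Real.log 2 + Real.log 5 + Real.log 7 := by
    rw [← Real.log_mul (by norm_num) (by norm_num), ← Real.log_mul (by norm_num) (by norm_num)]
    norm_num
  have e210 : Real.log 210 = Real.log 2 + Real.log 3 + Real.log 5 + Real.log 7 := by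
    rw [← Real.log_mul (by norm_num) (by norm_num), ← Real.log_mul (by norm_num) (by norm_num),
      ← Real.log_mul (by norm_num) (by norm_num)]
    norm_num
  rw [e6] at h6
  rw [e70] at h70
  rw [e210] at h210
  have a2 := Real.log_two_gt_d9
  have b2 := Real.log_two_lt_d9
  have a3 := log_ratio_lower 3 84 53 (by norm_num)
  have b3 := log_ratio_upper 3 149 94 (by norm_num) (by norm_num)
  have a5 := log_ratio_lower 5 339 146 (by norm_num)
  have b5 := log_ratio_upper 5 137 59 (by norm_num) (by norm_num)
  have a7 := log_ratio_lower 7 306 109 (by norm_num)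
  have b7 := log_ratio_upper 7 379 135 (by norm_num) (by norm_num)
  push_cast at a3 b3 a5 b5 a7 b7
  have hs : Real.log x ≤ 2 * (√x - 1) := by
    have := Real.log_le_sub_one_of_pos (Real.sqrt_pos.2 hx0)
    rw [Real.log_sqrt hx0.le] at this
    linarith
  have hA : ∃ A : ℝ, A = Real.log 2 * (1/2 + 1/210 - 1/6 - 1/70)
      + Real.log 3 * (1/3 + 1/210 - 1/6) + Real.log 5 * (1/5 + 1/210 - 1/70)
      + Real.log 7 * (1/7 + 1/210 - 1/70) := ⟨_, rfl⟩
  obtain ⟨A, hA⟩ := hA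
  have hA1 : 97875 / 100000 ≤ A := by rw [hA]; linarith
  have hA2 : A ≤ 97885 / 100000 := by rw [hA]; linarith
  have hA1' := mul_le_mul_of_nonneg_right hA1 hx0.le
  have hA2' := mul_le_mul_of_nonneg_right hA2 hx0.le
  rw [hA] at hA1' hA2'
  unfold sylU
  constructor <;> linarith

/-- Two-sided linear bound for `ψ` with square-root error. -/
def PsiBd (A B C : ℝ) : Prop :=
  ∀ x : ℝ, 0 < x → A * x - C * √x ≤ Chebyshev.psi x ∧ Chebyshev.psi x ≤ B * x + C * √x

lemma PsiBd.div {A B C : ℝ} (h : PsiBd A B C) (hC : 0 ≤ C) {x : ℝ} (hx : 0 < x) (k c : ℝ)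
    (hk : 0 < k) (hc : 0 ≤ c) (hck : 1 ≤ c ^ 2 * k) :
    A * (x / k) - c * (C * √x) ≤ Chebyshev.psi (x / k) ∧
      Chebyshev.psi (x / k) ≤ B * (x / k) + c * (C * √x) := by
  obtain ⟨h1, h2⟩ := h (x / k) (by positivity)
  have hs : √(x / k) ≤ c * √x := by
    rw [Real.sqrt_le_left (by positivity), mul_pow, Real.sq_sqrt hx.le, div_le_iff₀ hk]
    nlinarith
  have := mul_le_mul_of_nonneg_left hs hC
  constructor <;> linarith

lemma PsiBd.step {A B C : ℝ} (h : PsiBd A B C) (hC : 0 ≤ C) (A' B' C' : ℝ)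
    (hA' : A' ≤ 97875 / 100000 - B * (1/13 + 1/17 + 1/19 + 1/73) + A * (1/14 + 1/15 + 1/20))
    (hB' : 97885 / 100000 + B * (1/10 + 1/15 + 1/21 + 1/28) - A * (1/11 + 1/17 + 1/23) ≤ B')
    (hC' : 16 + 7 / 4 * C ≤ C') (hAC : A' ≤ C') (hB0 : 0 ≤ B') : PsiBd A' B' C' := by
  intro x hx
  have hsx : 0 < √x := Real.sqrt_pos.2 hx
  by_cases h1 : x < 1
  · rw [Chebyshev.psi_eq_zero_of_lt_two (by linarith)]
    have hx2 : x ≤ √x := by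
      rw [Real.le_sqrt' hx]; nlinarith
    constructor
    · nlinarith
    · have : 0 ≤ C' := by linarith
      positivity
  · push Not at h1
    obtain ⟨u1, u2⟩ := sylU_bounds x h1
    have r1 := psi_upper_rec x
    have r2 := psi_lower_rec x
    have k10 := (h.div hC hx 10 0.3163 (by norm_num) (by norm_num) (by norm_num)).2
    have k11 := (h.div hC hx 11 0.3016 (by norm_num) (by norm_num) (by norm_num)).1
    have k13 := (h.div hC hx 13 0.2774 (by norm_num) (by norm_num) (by norm_num)).2
    have k14 := (h.div hC hx 14 0.2673 (by norm_num) (by norm_num) (by norm_num)).1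
    obtain ⟨k15, k15'⟩ := h.div hC hx 15 0.2582 (by norm_num) (by norm_num) (by norm_num)
    obtain ⟨k17, k17'⟩ := h.div hC hx 17 0.2426 (by norm_num) (by norm_num) (by norm_num)
    have k19 := (h.div hC hx 19 0.2295 (by norm_num) (by norm_num) (by norm_num)).2
    have k20 := (h.div hC hx 20 0.2237 (by norm_num) (by norm_num) (by norm_num)).1
    have k21 := (h.div hC hx 21 0.2183 (by norm_num) (by norm_num) (by norm_num)).2
    have k23 := (h.div hC hx 23 0.2086 (by norm_num) (by norm_num) (by norm_num)).1
    have k28 := (h.div hC hx 28 0.189 (by norm_num) (by norm_num) (by norm_num)).2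
    have k73 := (h.div hC hx 73 0.1171 (by norm_num) (by norm_num) (by norm_num)).2
    have mA := mul_le_mul_of_nonneg_right hA' hx.le
    have mB := mul_le_mul_of_nonneg_right hB' hx.le
    have mC := mul_le_mul_of_nonneg_right hC' hsx.le
    have hCs : 0 ≤ C * √x := by positivity
    constructor <;> linarith

lemma psiBd_zero : PsiBd 0 (54 / 10) 0 := by
  intro x hx
  have h1 := Chebyshev.psi_nonneg x
  have h2 := Chebyshev.psi_le_const_mul_self hx.le
  have h4 : Real.log 4 ≤ 14 / 10 := by
    have : Real.log 4 = 2 * Real.log 2 := by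
      rw [show (4 : ℝ) = 2 ^ 2 by norm_num, Real.log_pow]; norm_num
    linarith [Real.log_two_lt_d9]
  constructor
  · simpa using h1
  · nlinarith

lemma psiBd_final : PsiBd 0.93853 1.06554 1864 := by
  have s1 := psiBd_zero.step (by norm_num) (-0.11247) 2.32885 16 (by norm_num) (by norm_num)
    (by norm_num) (by norm_num) (by norm_num)
  have s2 := s1.step (by norm_num) 0.48698 1.58280 44 (by norm_num) (by norm_num)
    (by norm_num) (by norm_num) (by norm_num)
  have s3 := s2.step (by norm_num) 0.75050 1.28047 93 (by norm_num) (by norm_num)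
    (by norm_num) (by norm_num) (by norm_num)
  have s4 := s3.step (by norm_num) 0.86116 1.15397 179 (by norm_num) (by norm_num)
    (by norm_num) (by norm_num) (by norm_num)
  have s5 := s4.step (by norm_num) 0.90753 1.10096 330 (by norm_num) (by norm_num)
    (by norm_num) (by norm_num) (by norm_num)
  have s6 := s5.step (by norm_num) 0.92697 1.07875 594 (by norm_num) (by norm_num)
    (by norm_num) (by norm_num) (by norm_num)
  have s7 := s6.step (by norm_num) 0.93511 1.06944 1056 (by norm_num) (by norm_num)
    (by norm_num) (by norm_num) (by norm_num)
  exact s7.step (by norm_num) 0.93853 1.06554 1864 (by norm_num) (by norm_num)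
    (by norm_num) (by norm_num) (by norm_num)

lemma theta_consecutive (p q : ℕ) (hpq : ConsecutivePrimes p q) :
    Chebyshev.theta q = Chebyshev.theta p + Real.log q := by
  obtain ⟨-, hq, hlt, hmin⟩ := hpq
  rw [Chebyshev.theta, Chebyshev.theta, Nat.floor_natCast, Nat.floor_natCast]
  have : (Finset.Ioc 0 q).filter Nat.Prime = insert q ((Finset.Ioc 0 p).filter Nat.Prime) := by
    ext r
    simp only [Finset.mem_filter, Finset.mem_Ioc, Finset.mem_insert]
    constructor
    · rintro ⟨⟨h0, h1⟩, hr⟩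
      by_cases h : r ≤ p
      · exact Or.inr ⟨⟨h0, h⟩, hr⟩
      · exact Or.inl (le_antisymm h1 (hmin r hr (by omega)))
    · rintro (rfl | ⟨⟨h0, h1⟩, hr⟩)
      · exact ⟨⟨hq.pos, le_rfl⟩, hq⟩
      · exact ⟨⟨h0, by omega⟩, hr⟩
  rw [this, Finset.sum_insert (by simp; omega), add_comm]

lemma large_case (p q : ℕ) (hpq : ConsecutivePrimes p q) (hp : 10 ^ 12 < p) :
    1000 * q < 1144 * p := by
  by_contra hcon
  push Not at hcon
  have hlt : p < q := hpq.2.2.1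
  have hth := theta_consecutive p q hpq
  have hcon' : (1144 : ℝ) * p ≤ 1000 * q := by exact_mod_cast hcon
  have hp' : (10 : ℝ) ^ 12 < p := by exact_mod_cast hp
  have hlt' : (p : ℝ) < q := by exact_mod_cast hlt
  have hp0 : (0 : ℝ) < p := by linarith [show (0 : ℝ) < 10 ^ 12 by norm_num]
  have hq0 : (0 : ℝ) < q := by linarith
  have b1 := (psiBd_final q hq0).1
  have b2 := (psiBd_final p hp0).2
  have b3 := Chebyshev.theta_le_psi (p : ℝ)
  have b4 := Chebyshev.psi_sub_theta_le (x := (q : ℝ)) (by linarith [show (1 : ℝ) < 10 ^ 12 by norm_num])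
  have b5 : √(p : ℝ) ≤ √(q : ℝ) := Real.sqrt_le_sqrt hlt'.le
  obtain ⟨s, hs⟩ : ∃ s, s = √(q : ℝ) := ⟨_, rfl⟩
  have hsq : s ^ 2 = q := by rw [hs, Real.sq_sqrt hq0.le]
  have hs6 : (10 : ℝ) ^ 6 ≤ s := by
    rw [hs, Real.le_sqrt (by norm_num) hq0.le]
    have : ((10 : ℝ) ^ 6) ^ 2 = 10 ^ 12 := by norm_num
    linarith
  have hs0 : 0 < s := by rw [hs]; exact Real.sqrt_pos.2 hq0
  have hlog : Real.log q = 2 * Real.log s := by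
    rw [← hsq, Real.log_pow]; norm_num
  have hK : Real.log s ≤ s / 16384 + 14 := by
    have e : Real.log s = Real.log (s / 2 ^ 14) + 14 * Real.log 2 := by
      rw [Real.log_div hs0.ne' (by norm_num), Real.log_pow]; norm_num
    have := Real.log_le_sub_one_of_pos (show 0 < s / 2 ^ 14 by positivity)
    have l2 := Real.log_two_lt_d9
    have e2 : s / 2 ^ 14 = s / 16384 := by norm_num
    linarith
  rw [← hs] at b1 b4 b5
  rw [hlog] at b4 hth
  have hsL : s * Real.log s ≤ s * (s / 16384 + 14) := mul_le_mul_of_nonneg_left hK hs0.le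
  rw [← hsq] at b1 hcon'
  have main : 0.93853 * s ^ 2 - 1864 * s - 4 * (s * Real.log s)
      ≤ 1.06554 * (1000 / 1144 * s ^ 2) + 1864 * s + 2 * Real.log s := by
    rw [← hsq] at hth b4
    nlinarith
  nlinarith

/-- For every pair of consecutive primes `p < q` with `q > 37`, one has
`1000·q < 1144·p`, i.e. `q/p < 1.144`. -/
theorem consecutive_prime_ratio (p q : ℕ) (hpq : ConsecutivePrimes p q) (hq : q > 37) :
    1000 * q < 1144 * p := by
  rcases le_or_gt p (10 ^ 12) with h | h
  · exact small_case p q hpq hq h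
  · exact large_case p q hpq h
end

section
/- For every pair of consecutive primes p < q with q > 37, one has 100·(q − 1) < 115·(p − 1) (equivalently, (q−1)/(p−1) < 1.15). -/
namespace ShiftedRatio

open Finset ArithmeticFunction

/-- Positive part of the coefficients of the factorial combination. -/
def posL : List ℕ := [7, 16, 24, 40, 42, 56, 70, 98, 105, 144, 240, 252, 252, 360]

/-- Negative part of the coefficients of the factorial combination. -/
def negL : List ℕ := [8, 14, 21, 35, 48, 49, 72, 80, 112, 120, 126, 245]

/-- Sum of the floors `⌊u / e⌋`. -/
def floorSum (l : List ℕ) (u : ℕ) : ℕ := (l.map fun e => u / e).sum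

/-- The test at one point, written with raw operations for fast evaluation. -/
def leafOk (a u : ℕ) : Bool := Nat.ble (Nat.add (Nat.add (Nat.add (Nat.add (Nat.add (Nat.add (Nat.add (Nat.add (Nat.add (Nat.add (Nat.add (Nat.add (Nat.add (Nat.div u 7) (Nat.div u 16)) (Nat.div u 24)) (Nat.div u 40)) (Nat.div u 42)) (Nat.div u 56)) (Nat.div u 70)) (Nat.div u 98)) (Nat.div u 105)) (Nat.div u 144)) (Nat.div u 240)) (Nat.div u 252)) (Nat.div u 252)) (Nat.div u 360))
  (Nat.add (Nat.add (Nat.add (Nat.add (Nat.add (Nat.add (Nat.add (Nat.add (Nat.add (Nat.add (Nat.add (Nat.add (Nat.div u 8) (Nat.div u 14)) (Nat.div u 21)) (Nat.div u 35)) (Nat.div u 48)) (Nat.div u 49)) (Nat.div u 72)) (Nat.div u 80)) (Nat.div u 112)) (Nat.div u 120)) (Nat.div u 126)) (Nat.div u 245)) a)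

theorem leafOk_spec (a u : ℕ) (h : leafOk a u = true) :
    floorSum posL u ≤ floorSum negL u + a := by
  have h1 := Nat.le_of_ble_eq_true h
  simp only [floorSum, posL, negL, List.map_cons, List.map_nil, List.sum_cons, List.sum_nil]
  simp only [← Nat.add_assoc, Nat.add_zero]
  exact h1

/-- Test of the inequality on the dyadic block of `2 ^ d` integers starting at `lo * 2 ^ d`. -/
def floorOk (a : ℕ) : ℕ → ℕ → Bool
  | 0, lo => Nat.rec true (fun n _ => leafOk a (Nat.succ n)) lo
  | d + 1, lo =>
    Bool.rec false (floorOk a d (Nat.add (Nat.mul lo 2) 1)) (floorOk a d (Nat.mul lo 2))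

theorem floorOk_spec (a : ℕ) : ∀ d lo, floorOk a d lo = true → ∀ u, lo * 2 ^ d ≤ u →
    u < (lo + 1) * 2 ^ d → floorSum posL u ≤ floorSum negL u + a := by
  intro d
  induction d with
  | zero =>
    intro lo h u h1 h2
    have hu : u = lo := by simp at h1 h2; omega
    subst hu
    cases u with
    | zero => simp [floorSum, posL, negL]
    | succ n => exact leafOk_spec a _ h
  | succ d ih =>
    intro lo h u h1 h2
    have h' : floorOk a d (lo * 2) = true ∧ floorOk a d (lo * 2 + 1) = true := by
      have h3 : (Bool.rec false (floorOk a d (lo * 2 + 1)) (floorOk a d (lo * 2)) : Bool) = true := h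
      cases hb : floorOk a d (lo * 2) with
      | false => rw [hb] at h3; simp at h3
      | true => rw [hb] at h3; exact ⟨rfl, h3⟩
    rw [pow_succ] at h1 h2
    by_cases hu : u < (lo * 2 + 1) * 2 ^ d
    · exact ih _ h'.1 u (by linarith) hu
    · exact ih _ h'.2 u (by omega) (by linarith)

theorem check_two : floorOk 2 15 0 = true ∧ floorOk 2 12 8 = true := by decide +kernel

theorem check_zero : floorOk 0 2 0 = true ∧ floorOk 0 1 2 = true ∧ floorOk 0 0 6 = true ∧
    floorOk 0 3 1 = true ∧ floorOk 0 4 1 = true ∧ floorOk 0 5 1 = true ∧ floorOk 0 6 1 = true ∧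
    floorOk 0 7 1 = true ∧ floorOk 0 8 1 = true ∧ floorOk 0 7 4 = true ∧ floorOk 0 6 10 = true ∧
    floorOk 0 5 22 = true ∧ floorOk 0 4 46 = true ∧ floorOk 0 3 94 = true ∧
    floorOk 0 1 380 = true ∧ floorOk 0 0 762 = true := by decide +kernel

theorem floorSum_le_zero {u : ℕ} (h8 : 8 ≤ u) (hu : u < 763) :
    floorSum posL u ≤ floorSum negL u := by
  obtain ⟨_, _, _, c1, c2, c3, c4, c5, c6, c7, c8, c9, c10, c11, c12, c13⟩ := check_zero
  have key : ∀ d lo, floorOk 0 d lo = true → lo * 2 ^ d ≤ u → u < (lo + 1) * 2 ^ d →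
    floorSum posL u ≤ floorSum negL u := fun d lo h a b => floorOk_spec 0 d lo h u a b
  rcases lt_or_ge u 16 with h | h
  · exact key _ _ c1 (by omega) (by omega)
  rcases lt_or_ge u 32 with h | h
  · exact key _ _ c2 (by omega) (by omega)
  rcases lt_or_ge u 64 with h | h
  · exact key _ _ c3 (by omega) (by omega)
  rcases lt_or_ge u 128 with h | h
  · exact key _ _ c4 (by omega) (by omega)
  rcases lt_or_ge u 256 with h | h
  · exact key _ _ c5 (by omega) (by omega)
  rcases lt_or_ge u 512 with h | h
  · exact key _ _ c6 (by omega) (by omega)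
  rcases lt_or_ge u 640 with h | h
  · exact key _ _ c7 (by omega) (by omega)
  rcases lt_or_ge u 704 with h | h
  · exact key _ _ c8 (by omega) (by omega)
  rcases lt_or_ge u 736 with h | h
  · exact key _ _ c9 (by omega) (by omega)
  rcases lt_or_ge u 752 with h | h
  · exact key _ _ c10 (by omega) (by omega)
  rcases lt_or_ge u 760 with h | h
  · exact key _ _ c11 (by omega) (by omega)
  rcases lt_or_ge u 762 with h | h
  · exact key _ _ c12 (by omega) (by omega)
  · exact key _ _ c13 (by omega) (by omega)

theorem floorSum_add (l : List ℕ) (hl : ∀ e ∈ l, e ∣ 35280 ∧ 0 < e) (u : ℕ) :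
    floorSum l (u + 35280) = floorSum l u + floorSum l 35280 := by
  induction l with
  | nil => simp [floorSum]
  | cons e l ih =>
    have h1 := ih (fun x hx => hl x (List.mem_cons_of_mem _ hx))
    have h2 := hl e List.mem_cons_self
    simp only [floorSum, List.map_cons, List.sum_cons] at h1 ⊢
    rw [h1, Nat.add_div_of_dvd_left h2.1]
    ring

theorem floorSum_le_two (u : ℕ) : floorSum posL u ≤ floorSum negL u + 2 := by
  induction u using Nat.strong_induction_on with
  | _ u ih =>
    rcases lt_or_ge u 35280 with h | h
    · rcases lt_or_ge u 32768 with h' | h'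
      · exact floorOk_spec 2 _ _ check_two.1 u (by omega) (by omega)
      · exact floorOk_spec 2 _ _ check_two.2 u (by omega) (by omega)
    · obtain ⟨v, rfl⟩ := Nat.exists_eq_add_of_le' h
      rw [floorSum_add posL (by decide) v, floorSum_add negL (by decide) v]
      have h0 : floorSum posL 35280 = floorSum negL 35280 := by decide
      have := ih v (by omega)
      omega

theorem floorSum_small {u : ℕ} (h : u < 7) : floorSum posL u ≤ floorSum negL u := by
  interval_cases u <;> decide

/-- The pointwise bound for the factorial combination. -/
theorem floorSum_bound (u : ℕ) : floorSum posL u + (if 8 ≤ u then 1 else 0) ≤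
    floorSum negL u + (if 7 ≤ u then 1 else 0) + 2 * (if 763 ≤ u then 1 else 0) := by
  rcases lt_or_ge u 7 with h | h
  · have := floorSum_small h
    simp [show ¬ 8 ≤ u by omega]; omega
  rcases lt_or_ge u 8 with h' | h'
  · have : u = 7 := by omega
    subst this; decide
  rcases lt_or_ge u 763 with h'' | h''
  · have := floorSum_le_zero h' h''
    simp [h, h', show ¬ 763 ≤ u by omega]; omega
  · have := floorSum_le_two u
    simp [h, h', h'']; omega

/-- Legendre's formula in logarithmic form. -/
theorem log_factorial_eq (N : ℕ) : ∀ M ≤ N,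
    Real.log (M.factorial : ℝ) = ∑ m ∈ Icc 1 N, vonMangoldt m * ((M / m : ℕ) : ℝ) := by
  intro M
  induction M with
  | zero => intro _; simp
  | succ M ih =>
    intro hM
    rw [Nat.factorial_succ, Nat.cast_mul, Real.log_mul (by positivity) (by positivity),
      ih (by omega), ← vonMangoldt_sum]
    have h1 : ∑ i ∈ (M + 1).divisors, vonMangoldt i =
        ∑ m ∈ Icc 1 N, vonMangoldt m * (if m ∣ M + 1 then 1 else 0) := by
      simp only [mul_ite, mul_one, mul_zero]
      rw [← Finset.sum_filter]
      apply Finset.sum_congr _ (fun _ _ => rfl)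
      ext d
      simp only [Nat.mem_divisors, Finset.mem_filter, Finset.mem_Icc]
      constructor
      · rintro ⟨h, _⟩
        have := Nat.le_of_dvd (by omega) h
        have := Nat.pos_of_dvd_of_pos h (by omega)
        exact ⟨⟨by omega, by omega⟩, h⟩
      · rintro ⟨_, h⟩
        exact ⟨h, by omega⟩
    rw [h1, ← Finset.sum_add_distrib]
    apply Finset.sum_congr rfl
    intro m _
    rw [Nat.succ_div]
    push_cast
    ring

/-- The sum of `log ⌊N / e⌋!` over a list. -/
noncomputable def facSum (l : List ℕ) (N : ℕ) : ℝ :=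
  (l.map fun e => Real.log ((N / e).factorial : ℝ)).sum

theorem facSum_eq (l : List ℕ) (N : ℕ) :
    facSum l N = ∑ m ∈ Icc 1 N, vonMangoldt m * (floorSum l (N / m) : ℝ) := by
  induction l with
  | nil => simp [facSum, floorSum]
  | cons e l ih =>
    simp only [facSum, floorSum, List.map_cons, List.sum_cons] at ih ⊢
    rw [ih, log_factorial_eq N (N / e) (Nat.div_le_self _ _), ← Finset.sum_add_distrib]
    apply Finset.sum_congr rfl
    intro m _
    rw [Nat.div_div_eq_div_mul, Nat.div_div_eq_div_mul, mul_comm e m]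
    push_cast
    ring

theorem sum_ite_eq_psi (N k : ℕ) (hk : 0 < k) :
    ∑ m ∈ Icc 1 N, vonMangoldt m * (if k ≤ N / m then (1 : ℝ) else 0) =
      Chebyshev.psi ((N / k : ℕ) : ℝ) := by
  rw [Chebyshev.psi, Nat.floor_natCast]
  simp only [mul_ite, mul_one, mul_zero]
  rw [← Finset.sum_filter]
  apply Finset.sum_congr _ (fun _ _ => rfl)
  ext m
  simp only [Finset.mem_filter, Finset.mem_Icc, Finset.mem_Ioc]
  constructor
  · rintro ⟨⟨h1, h2⟩, h3⟩
    rw [Nat.le_div_iff_mul_le (by omega)] at h3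
    refine ⟨by omega, ?_⟩
    rw [Nat.le_div_iff_mul_le hk]; linarith
  · rintro ⟨h1, h2⟩
    have := Nat.div_le_self N k
    refine ⟨⟨by omega, by omega⟩, ?_⟩
    rw [Nat.le_div_iff_mul_le hk] at h2
    rw [Nat.le_div_iff_mul_le (by omega)]; linarith

theorem facSum_upper (N : ℕ) : facSum posL N - facSum negL N ≤
    Chebyshev.psi ((N / 7 : ℕ) : ℝ) - Chebyshev.psi ((N / 8 : ℕ) : ℝ)
      + 2 * Chebyshev.psi ((N / 763 : ℕ) : ℝ) := by
  rw [facSum_eq, facSum_eq, ← sum_ite_eq_psi N 7 (by norm_num), ← sum_ite_eq_psi N 8 (by norm_num),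
    ← sum_ite_eq_psi N 763 (by norm_num), Finset.mul_sum, ← Finset.sum_sub_distrib,
    ← Finset.sum_sub_distrib, ← Finset.sum_add_distrib]
  apply Finset.sum_le_sum
  intro m _
  have h := floorSum_bound (N / m)
  have h' : (floorSum posL (N / m) : ℝ) + (if 8 ≤ N / m then 1 else 0) ≤
    floorSum negL (N / m) + (if 7 ≤ N / m then 1 else 0) + 2 * (if 763 ≤ N / m then 1 else 0) := by
    exact_mod_cast h
  have h0 : 0 ≤ vonMangoldt m := vonMangoldt_nonneg
  nlinarith [mul_le_mul_of_nonneg_left h' h0]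

/-- The main term of `log x!`. -/
noncomputable def mainT (x : ℝ) : ℝ := x * Real.log x - x

theorem log_succ_sub (M : ℕ) (hM : 1 ≤ M) :
    1 ≤ ((M : ℝ) + 1) * (Real.log (M + 1) - Real.log M) ∧
      (M : ℝ) * (Real.log (M + 1) - Real.log M) ≤ 1 := by
  have hM' : (1 : ℝ) ≤ M := by exact_mod_cast hM
  rw [← Real.log_div (by positivity) (by positivity)]
  have hpos : (0 : ℝ) < (M + 1) / M := by positivity
  have h1 := Real.one_sub_inv_le_log_of_pos hpos
  have h2 := Real.log_le_sub_one_of_pos hpos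
  constructor
  · calc (1 : ℝ) = (M + 1) * (1 - ((M + 1) / M : ℝ)⁻¹) := by field_simp; ring
      _ ≤ _ := by gcongr
  · calc (M : ℝ) * Real.log ((M + 1) / M) ≤ M * ((M + 1) / M - 1) := by gcongr
      _ = 1 := by field_simp; ring

theorem log_factorial_bounds (M : ℕ) (hM : 1 ≤ M) :
    mainT M ≤ Real.log (M.factorial : ℝ) ∧
      Real.log (M.factorial : ℝ) ≤ mainT M + 1 + Real.log M := by
  induction M, hM using Nat.le_induction with
  | base => simp [mainT]
  | succ M hM ih =>
    obtain ⟨h1, h2⟩ := log_succ_sub M hM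
    rw [Nat.factorial_succ, Nat.cast_mul, Real.log_mul (by positivity) (by positivity)]
    unfold mainT at *
    push_cast
    constructor <;> nlinarith [ih.1, ih.2]

theorem mainT_mono {x y : ℝ} (hx : 1 ≤ x) (hxy : x ≤ y) (hy : y ≤ x + 1) :
    mainT x ≤ mainT y ∧ mainT y ≤ mainT x + Real.log y := by
  unfold mainT
  have hx0 : 0 < x := by linarith
  have hy0 : 0 < y := by linarith
  have h1 : 1 - (y / x)⁻¹ ≤ Real.log (y / x) := Real.one_sub_inv_le_log_of_pos (by positivity)
  have h2 : Real.log (y / x) ≤ y / x - 1 := Real.log_le_sub_one_of_pos (by positivity)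
  rw [Real.log_div hy0.ne' hx0.ne'] at h1 h2
  have hlx : 0 ≤ Real.log x := Real.log_nonneg hx
  have hly : 0 ≤ Real.log y := Real.log_nonneg (by linarith)
  have h3 : y - x ≤ y * (Real.log y - Real.log x) := by
    calc y - x = y * (1 - (y / x)⁻¹) := by field_simp
      _ ≤ _ := by gcongr
  have h4 : x * (Real.log y - Real.log x) ≤ y - x := by
    calc x * (Real.log y - Real.log x) ≤ x * (y / x - 1) := by gcongr
      _ = _ := by field_simp
  constructor <;> nlinarith

theorem log_factorial_div_bounds (N e : ℕ) (he : 7 ≤ e) (hN : e ≤ N) :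
    mainT ((N : ℝ) / e) - Real.log N ≤ Real.log ((N / e).factorial : ℝ) ∧
      Real.log ((N / e).factorial : ℝ) ≤ mainT ((N : ℝ) / e) + Real.log N := by
  have hM : 1 ≤ N / e := by rw [Nat.le_div_iff_mul_le (by omega)]; omega
  have he0 : (0 : ℝ) < e := by exact_mod_cast (by omega : 0 < e)
  have hN0 : (0 : ℝ) < N := by exact_mod_cast (by omega : 0 < N)
  obtain ⟨h1, h2⟩ := log_factorial_bounds (N / e) hM
  have hM' : (1 : ℝ) ≤ ((N / e : ℕ) : ℝ) := by exact_mod_cast hM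
  have hle : ((N / e : ℕ) : ℝ) ≤ (N : ℝ) / e := Nat.cast_div_le
  have hlt : (N : ℝ) / e ≤ ((N / e : ℕ) : ℝ) + 1 := by
    rw [div_le_iff₀ he0]
    have := Nat.lt_div_mul_add (a := N) (b := e) (by omega)
    have h' : (N : ℝ) ≤ ((N / e : ℕ) : ℝ) * e + e := by exact_mod_cast this.le
    linarith
  obtain ⟨h3, h4⟩ := mainT_mono hM' hle hlt
  have hl1 : Real.log ((N / e : ℕ) : ℝ) ≤ Real.log ((N : ℝ) / e) :=
    Real.log_le_log (by linarith) hle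
  have hl2 : Real.log ((N : ℝ) / e) + 1 ≤ Real.log N := by
    rw [Real.log_div hN0.ne' he0.ne']
    have : (1 : ℝ) ≤ Real.log e := by
      rw [Real.le_log_iff_exp_le he0]
      have := Real.exp_one_lt_d9
      have h7 : (7 : ℝ) ≤ e := by exact_mod_cast he
      linarith
    linarith
  constructor <;> linarith

theorem facSum_bounds (l : List ℕ) (N : ℕ) (hl : ∀ e ∈ l, 7 ≤ e ∧ e ≤ N) :
    (l.map fun e : ℕ => mainT ((N : ℝ) / (e : ℝ))).sum - l.length * Real.log N ≤ facSum l N ∧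
    facSum l N ≤ (l.map fun e : ℕ => mainT ((N : ℝ) / (e : ℝ))).sum + l.length * Real.log N := by
  induction l with
  | nil => simp [facSum]
  | cons e l ih =>
    have h1 := ih (fun x hx => hl x (List.mem_cons_of_mem _ hx))
    have h2 := hl e List.mem_cons_self
    have h3 := log_factorial_div_bounds N e h2.1 h2.2
    simp only [facSum, List.map_cons, List.sum_cons, List.length_cons] at h1 ⊢
    push_cast
    constructor <;> linarith [h1.1, h1.2, h3.1, h3.2]

theorem sum_mainT (l : List ℕ) (N : ℕ) (hN : 0 < N) (hl : ∀ e ∈ l, 0 < e) :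
    (l.map fun e : ℕ => mainT ((N : ℝ) / (e : ℝ))).sum =
      N * (Real.log N - 1) * (l.map fun e : ℕ => (1 : ℝ) / (e : ℝ)).sum
        - N * (l.map fun e : ℕ => Real.log (e : ℝ) / (e : ℝ)).sum := by
  induction l with
  | nil => simp
  | cons e l ih =>
    have h1 := ih (fun x hx => hl x (List.mem_cons_of_mem _ hx))
    have he : (0 : ℝ) < e := by exact_mod_cast hl e List.mem_cons_self
    have hN' : (0 : ℝ) < N := by exact_mod_cast hN
    simp only [List.map_cons, List.sum_cons]
    rw [h1, mainT, Real.log_div hN'.ne' he.ne']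
    field_simp
    ring

theorem lg (x : ℝ) (a b c d : ℕ) (h : x = 2 ^ a * 3 ^ b * 5 ^ c * 7 ^ d) :
    Real.log x = a * Real.log 2 + b * Real.log 3 + c * Real.log 5 + d * Real.log 7 := by
  rw [h, Real.log_mul (by positivity) (by positivity), Real.log_mul (by positivity) (by positivity),
    Real.log_mul (by positivity) (by positivity), Real.log_pow, Real.log_pow, Real.log_pow,
    Real.log_pow]

theorem main_const : (0.00592 : ℝ) ≤ (negL.map fun e : ℕ => Real.log (e : ℝ) / (e : ℝ)).sum
    - (posL.map fun e : ℕ => Real.log (e : ℝ) / (e : ℝ)).sum := by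
  have h3 : 84 * Real.log 2 ≤ 53 * Real.log 3 := by
    have := Real.log_le_log (by norm_num) (show (2 : ℝ) ^ 84 ≤ 3 ^ 53 by norm_num)
    simpa [Real.log_pow] using this
  have h5 : 31 * Real.log 5 ≤ 72 * Real.log 2 := by
    have := Real.log_le_log (by norm_num) (show (5 : ℝ) ^ 31 ≤ 2 ^ 72 by norm_num)
    simpa [Real.log_pow] using this
  have h7 : 26 * Real.log 7 ≤ 73 * Real.log 2 := by
    have := Real.log_le_log (by norm_num) (show (7 : ℝ) ^ 26 ≤ 2 ^ 73 by norm_num)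
    simpa [Real.log_pow] using this
  have h2 := Real.log_two_gt_d9
  simp only [posL, negL, List.map_cons, List.map_nil, List.sum_cons, List.sum_nil, Nat.cast_ofNat]
  rw [lg 8 3 0 0 0 (by norm_num), lg 14 1 0 0 1 (by norm_num), lg 16 4 0 0 0 (by norm_num),
    lg 21 0 1 0 1 (by norm_num), lg 24 3 1 0 0 (by norm_num), lg 35 0 0 1 1 (by norm_num),
    lg 40 3 0 1 0 (by norm_num), lg 42 1 1 0 1 (by norm_num), lg 48 4 1 0 0 (by norm_num),
    lg 49 0 0 0 2 (by norm_num), lg 56 3 0 0 1 (by norm_num), lg 70 1 0 1 1 (by norm_num),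
    lg 72 3 2 0 0 (by norm_num), lg 80 4 0 1 0 (by norm_num), lg 98 1 0 0 2 (by norm_num),
    lg 105 0 1 1 1 (by norm_num), lg 112 4 0 0 1 (by norm_num), lg 120 3 1 1 0 (by norm_num),
    lg 126 1 2 0 1 (by norm_num), lg 144 4 2 0 0 (by norm_num), lg 240 4 1 1 0 (by norm_num),
    lg 245 0 0 1 2 (by norm_num), lg 252 2 2 0 1 (by norm_num), lg 360 3 2 1 0 (by norm_num)]
  push_cast
  linarith

theorem facSum_lower (N : ℕ) (hN : 360 ≤ N) :
    0.00592 * (N : ℝ) - 26 * Real.log N ≤ facSum posL N - facSum negL N := by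
  have hp := (facSum_bounds posL N (by
    intro e he
    have : 7 ≤ e ∧ e ≤ 360 := by revert e; decide
    omega)).1
  have hn := (facSum_bounds negL N (by
    intro e he
    have : 7 ≤ e ∧ e ≤ 360 := by revert e; decide
    omega)).2
  rw [sum_mainT _ N (by omega) (by decide)] at hp hn
  have hs : (posL.map fun e : ℕ => (1 : ℝ) / (e : ℝ)).sum =
      (negL.map fun e : ℕ => (1 : ℝ) / (e : ℝ)).sum := by
    simp only [posL, negL, List.map_cons, List.map_nil, List.sum_cons, List.sum_nil,
      Nat.cast_ofNat]
    norm_num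
  have hc := mul_le_mul_of_nonneg_left main_const (Nat.cast_nonneg (α := ℝ) N)
  rw [hs] at hp
  have l1 : (posL.length : ℝ) = 14 := by simp [posL]
  have l2 : (negL.length : ℝ) = 12 := by simp [negL]
  rw [l1] at hp
  rw [l2] at hn
  linarith

theorem sqrt_div_le (y N c : ℝ) (hc : 0 ≤ c) (h : y ≤ c ^ 2 * N) : √y ≤ c * √N := by
  calc √y ≤ √(c ^ 2 * N) := Real.sqrt_le_sqrt h
    _ = c * √N := by rw [Real.sqrt_mul (by positivity), Real.sqrt_sq hc]

theorem exists_prime_large (n : ℕ) (hn : 10000000 ≤ n) :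
    ∃ r : ℕ, r.Prime ∧ n < r ∧ r ≤ (8 * n + 7) / 7 := by
  by_contra! hno
  obtain ⟨N, hNdef⟩ : ∃ N, N = 8 * n + 7 := ⟨_, rfl⟩
  rw [← hNdef] at hno
  have hlow := facSum_lower N (by omega)
  have hup := facSum_upper N
  have hN8 : N / 8 = n := by omega
  rw [hN8] at hup
  have hNr : (80000000 : ℝ) ≤ N := by exact_mod_cast (by omega : 80000000 ≤ N)
  have hN0 : (0 : ℝ) < N := by linarith
  -- the two theta values agree
  have hth : Chebyshev.theta ((N / 7 : ℕ) : ℝ) = Chebyshev.theta (n : ℝ) := by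
    rw [Chebyshev.theta, Chebyshev.theta, Nat.floor_natCast, Nat.floor_natCast]
    apply Finset.sum_congr _ (fun _ _ => rfl)
    ext r
    simp only [Finset.mem_filter, Finset.mem_Ioc]
    constructor
    · rintro ⟨⟨h1, h2⟩, h3⟩
      refine ⟨⟨h1, ?_⟩, h3⟩
      by_contra! h4
      have := hno r h3 h4
      omega
    · rintro ⟨⟨h1, h2⟩, h3⟩
      exact ⟨⟨h1, by omega⟩, h3⟩
  have ha1 : (1 : ℝ) ≤ ((N / 7 : ℕ) : ℝ) := by exact_mod_cast (by omega : 1 ≤ N / 7)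
  have hb1 : (1 : ℝ) ≤ ((N / 763 : ℕ) : ℝ) := by exact_mod_cast (by omega : 1 ≤ N / 763)
  have hpt := Chebyshev.psi_sub_theta_le ha1
  have htp := Chebyshev.theta_le_psi (n : ℝ)
  have hps := Chebyshev.psi_le hb1
  have ha : ((N / 7 : ℕ) : ℝ) ≤ (N : ℝ) / 7 := by exact_mod_cast Nat.cast_div_le (α := ℝ)
  have hb : ((N / 763 : ℕ) : ℝ) ≤ (N : ℝ) / 763 := by exact_mod_cast Nat.cast_div_le (α := ℝ)
  have sa : √((N / 7 : ℕ) : ℝ) ≤ 0.378 * √N := sqrt_div_le _ _ _ (by norm_num) (by linarith)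
  have sb : √((N / 763 : ℕ) : ℝ) ≤ 0.0363 * √N := sqrt_div_le _ _ _ (by norm_num) (by linarith)
  have la : Real.log ((N / 7 : ℕ) : ℝ) ≤ Real.log N := Real.log_le_log (by linarith) (by linarith)
  have lb : Real.log ((N / 763 : ℕ) : ℝ) ≤ Real.log N := Real.log_le_log (by linarith) (by linarith)
  have la0 := Real.log_nonneg ha1
  have lb0 := Real.log_nonneg hb1
  have hs0 : 0 ≤ √(N : ℝ) := Real.sqrt_nonneg _
  have hss : √(N : ℝ) * √N = N := Real.mul_self_sqrt hN0.le
  have hs : (8944 : ℝ) ≤ √N := Real.le_sqrt_of_sq_le (by linarith)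
  have pa : √((N / 7 : ℕ) : ℝ) * Real.log ((N / 7 : ℕ) : ℝ) ≤ 0.378 * √N * Real.log N := by gcongr
  have pb : √((N / 763 : ℕ) : ℝ) * Real.log ((N / 763 : ℕ) : ℝ) ≤ 0.0363 * √N * Real.log N := by
    gcongr
  have l4 : Real.log 4 ≤ 1.3863 := by
    have h := Real.log_two_lt_d9
    have : Real.log 4 = 2 * Real.log 2 := by
      rw [show (4 : ℝ) = 2 ^ 2 by norm_num, Real.log_pow]; norm_num
    linarith
  have p4 : Real.log 4 * ((N / 763 : ℕ) : ℝ) ≤ 1.3863 * ((N : ℝ) / 763) := by gcongr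
  -- tangent bound for the logarithm
  have hl : Real.log N ≤ 2 * (√N / 8100 + 8) := by
    have e1 : Real.log N = 2 * Real.log √N := by
      rw [Real.log_sqrt hN0.le]; ring
    have e2 : Real.log √N - 9 + 1 ≤ Real.exp (Real.log √N - 9) := Real.add_one_le_exp _
    rw [Real.exp_sub, Real.exp_log (by linarith)] at e2
    have e3 : (8100 : ℝ) ≤ Real.exp 9 := by
      have h := Real.exp_one_gt_d9
      have : Real.exp 9 = Real.exp 1 ^ 9 := by rw [← Real.exp_nat_mul]; norm_num
      rw [this]
      calc (8100 : ℝ) ≤ 2.7182818283 ^ 9 := by norm_num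
        _ ≤ _ := by gcongr
    have e4 : √(N : ℝ) / Real.exp 9 ≤ √N / 8100 := by gcongr
    linarith
  have hl0 : 0 ≤ Real.log (N : ℝ) := Real.log_nonneg (by linarith)
  have hfin : 0.002286 * (√(N : ℝ) * √N) ≤ 0.9012 * √N * Real.log N + 26 * Real.log N := by
    rw [hss]
    nlinarith
  have h26 : 26 * Real.log N ≤ 0.003 * √N * Real.log N := by
    apply mul_le_mul_of_nonneg_right _ hl0
    linarith
  have hsl : √(N : ℝ) * Real.log N ≤ √N * (2 * (√N / 8100 + 8)) := by gcongr
  nlinarith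

theorem chain_step (p q : ℕ) (hpq : ConsecutivePrimes p q) (l : List ℕ) : ∀ a, a ≤ p →
    List.IsChain (fun x y => 100 * (y - 1) < 115 * (x - 1)) (a :: l) → (∀ b ∈ l, b.Prime) →
    (∃ b ∈ a :: l, p < b) → 100 * (q - 1) < 115 * (p - 1) := by
  induction l with
  | nil =>
    rintro a ha - - ⟨b, hb, hpb⟩
    simp at hb
    omega
  | cons c l ih =>
    rintro a ha hch hpr ⟨b, hb, hpb⟩
    rw [List.isChain_cons_cons] at hch
    by_cases hc : p < c
    · have := hpq.2.2.2 c (hpr c List.mem_cons_self) hc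
      have := hch.1
      omega
    · refine ih c (by omega) hch.2 (fun b hb => hpr b (List.mem_cons_of_mem _ hb)) ⟨b, ?_, hpb⟩
      rcases List.mem_cons.1 hb with h | h
      · omega
      · exact h

/-- A chain of primes with small ratios. -/
def chainL : List ℕ := [41, 43, 47, 53, 59, 67, 73, 83, 89, 101, 113, 127, 139, 157, 179, 199, 227, 257, 293, 331,
  379, 433, 491, 563, 647, 743, 853, 977, 1123, 1291, 1483, 1699, 1951, 2243, 2579, 2963,
  3407, 3917, 4493, 5153, 5923, 6803, 7823, 8971, 10313, 11839, 13613, 15649, 17989, 20681,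
  23773, 27337, 31397, 36097, 41507, 47717, 54869, 63097, 72559, 83437, 95947, 110323,
  126859, 145879, 167759, 192917, 221849, 255121, 293357, 337349, 387917, 446087, 512999,
  589933, 678421, 780179, 897191, 1031761, 1186519, 1364491, 1569163, 1804529, 2075201,
  2386471, 2744419, 3156073, 3629477, 4173887, 4799957, 5519933, 6347921, 7300079, 8395087,
  9654349, 11102477]

theorem chainL_prime : ∀ b ∈ chainL, b.Prime := by
  unfold chainL
  simp only [List.forall_mem_cons, List.not_mem_nil, false_imp_iff, implies_true, and_true]
  refine ⟨?_, ?_, ?_, ?_, ?_, ?_, ?_, ?_, ?_, ?_, ?_, ?_, ?_, ?_, ?_, ?_, ?_, ?_, ?_, ?_, ?_, ?_,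
    ?_, ?_, ?_, ?_, ?_, ?_, ?_, ?_, ?_, ?_, ?_, ?_, ?_, ?_, ?_, ?_, ?_, ?_, ?_, ?_, ?_, ?_,
    ?_, ?_, ?_, ?_, ?_, ?_, ?_, ?_, ?_, ?_, ?_, ?_, ?_, ?_, ?_, ?_, ?_, ?_, ?_, ?_, ?_, ?_,
    ?_, ?_, ?_, ?_, ?_, ?_, ?_, ?_, ?_, ?_, ?_, ?_, ?_, ?_, ?_, ?_, ?_, ?_, ?_, ?_, ?_, ?_,
    ?_, ?_, ?_, ?_, ?_, ?_, ?_⟩ <;> norm_num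

theorem chainL_chain :
    List.IsChain (fun x y => 100 * (y - 1) < 115 * (x - 1)) (37 :: chainL) := by
  decide +kernel

end ShiftedRatio

/-- For every pair of consecutive primes `p < q` with `q > 37`, one has
`100·(q − 1) < 115·(p − 1)`, i.e. `(q−1)/(p−1) < 1.15`. -/
theorem consecutive_prime_shifted_ratio (p q : ℕ) (hpq : ConsecutivePrimes p q)
    (hq : q > 37) : 100 * (q - 1) < 115 * (p - 1) := by
  have hp : 37 ≤ p := by
    by_contra! h
    have := hpq.2.2.2 37 (by norm_num) h
    omega
  rcases lt_or_ge p 10000000 with h | h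
  · refine ShiftedRatio.chain_step p q hpq ShiftedRatio.chainL 37 hp ShiftedRatio.chainL_chain
      ShiftedRatio.chainL_prime ⟨11102477, ?_, by omega⟩
    simp [ShiftedRatio.chainL]
  · obtain ⟨r, hr, h1, h2⟩ := ShiftedRatio.exists_prime_large p h
    have := hpq.2.2.2 r hr h1
    omega
end

section
/- Let p < q be consecutive primes with q > 37, and let k be an even integer with p < k < q. Then k − 2 ≥ p − 1, and consequently 5·(q − 1) < 6·(k − 2) (equivalently, (q−1)/(k−2) < 6/5). -/
open ArithmeticFunction in
lemma aux_log_factorial (N n : ℕ) (h : n ≤ N) :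
    Real.log (n.factorial) = ∑ d ∈ Finset.Ioc 0 N, vonMangoldt d * ((n / d : ℕ) : ℝ) := by
  induction n with
  | zero => simp
  | succ n ih =>
    rw [Nat.factorial_succ, Nat.cast_mul, Real.log_mul (by positivity) (by positivity),
      ih (by omega), ← vonMangoldt_sum]
    have h1 : ∀ d, (((n + 1) / d : ℕ) : ℝ) = ((n / d : ℕ) : ℝ) + if d ∣ n + 1 then 1 else 0 := by
      intro d
      rw [Nat.succ_div]
      split_ifs <;> simp
    simp_rw [h1, mul_add, Finset.sum_add_distrib, mul_ite, mul_one, mul_zero,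
      ← Finset.sum_filter]
    rw [add_comm]
    congr 1
    apply Finset.sum_congr _ (fun _ _ => rfl)
    ext d
    simp only [Nat.mem_divisors, Finset.mem_filter, Finset.mem_Ioc]
    constructor
    · rintro ⟨h2, h3⟩
      exact ⟨⟨Nat.pos_of_dvd_of_pos h2 (by omega), (Nat.le_of_dvd (by omega) h2).trans h⟩, h2⟩
    · rintro ⟨h2, h3⟩
      exact ⟨h3, by omega⟩

open ArithmeticFunction in
lemma aux_psi (N k : ℕ) (hk : 0 < k) :
    Chebyshev.psi ((N / k : ℕ) : ℝ)
      = ∑ d ∈ Finset.Ioc 0 N, vonMangoldt d * (if k ≤ N / d then 1 else 0 : ℝ) := by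
  simp only [Chebyshev.psi, Nat.floor_natCast, mul_ite, mul_one, mul_zero, ← Finset.sum_filter]
  apply Finset.sum_congr _ (fun _ _ => rfl)
  ext d
  simp only [Finset.mem_filter, Finset.mem_Ioc]
  constructor
  · rintro ⟨h1, h2⟩
    rw [Nat.le_div_iff_mul_le hk] at h2
    refine ⟨⟨h1, le_trans (Nat.le_mul_of_pos_right _ hk) h2⟩, ?_⟩
    rw [Nat.le_div_iff_mul_le h1, mul_comm]; exact h2
  · rintro ⟨⟨h1, h2⟩, h3⟩
    rw [Nat.le_div_iff_mul_le h1] at h3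
    refine ⟨h1, ?_⟩
    rw [Nat.le_div_iff_mul_le hk, mul_comm]; exact h3

/-- Logarithm of the factorial of `N / k`. -/
noncomputable def auxT (N k : ℕ) : ℝ := Real.log ((N / k).factorial)

/-- Chebyshev's combination of factorials. -/
noncomputable def auxS (N : ℕ) : ℝ :=
  auxT N 1 - auxT N 2 - auxT N 3 - auxT N 5 + auxT N 30

open ArithmeticFunction in
lemma auxS_eq (N : ℕ) : auxS N = ∑ d ∈ Finset.Ioc 0 N, vonMangoldt d *
    ((((N / d : ℕ) : ℤ) - ((N / d / 2 : ℕ) : ℤ) - ((N / d / 3 : ℕ) : ℤ) - ((N / d / 5 : ℕ) : ℤ)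
      + ((N / d / 30 : ℕ) : ℤ) : ℤ) : ℝ) := by
  have h : ∀ k, auxT N k = ∑ d ∈ Finset.Ioc 0 N, vonMangoldt d * ((N / d / k : ℕ) : ℝ) := by
    intro k
    rw [auxT, aux_log_factorial N (N / k) (Nat.div_le_self _ _)]
    refine Finset.sum_congr rfl fun d _ => ?_
    rw [Nat.div_div_eq_div_mul, Nat.div_div_eq_div_mul, mul_comm k d]
  rw [auxS]
  simp only [h, ← Finset.sum_sub_distrib, ← Finset.sum_add_distrib]
  refine Finset.sum_congr rfl fun d _ => ?_
  rw [Nat.div_one]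
  simp only [Int.cast_add, Int.cast_sub, Int.cast_natCast]
  ring

lemma auxS_le (N : ℕ) : auxS N ≤ Chebyshev.psi (N : ℝ) := by
  have h := aux_psi N 1 one_pos
  rw [Nat.div_one] at h
  rw [h, auxS_eq]
  refine Finset.sum_le_sum fun d _ => ?_
  refine mul_le_mul_of_nonneg_left ?_ ArithmeticFunction.vonMangoldt_nonneg
  generalize N / d = m
  have : ((m : ℤ) - ((m / 2 : ℕ) : ℤ) - ((m / 3 : ℕ) : ℤ)
        - ((m / 5 : ℕ) : ℤ) + ((m / 30 : ℕ) : ℤ)) ≤ (if 1 ≤ m then 1 else 0 : ℤ) := by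
    split_ifs <;> omega
  exact_mod_cast this

lemma auxS_ge (N : ℕ) : Chebyshev.psi (N : ℝ) - Chebyshev.psi ((N / 6 : ℕ) : ℝ)
    + Chebyshev.psi ((N / 7 : ℕ) : ℝ) - Chebyshev.psi ((N / 10 : ℕ) : ℝ) ≤ auxS N := by
  have h := aux_psi N 1 one_pos
  rw [Nat.div_one] at h
  rw [h, auxS_eq, aux_psi N 6 (by norm_num), aux_psi N 7 (by norm_num),
    aux_psi N 10 (by norm_num)]
  simp only [← Finset.sum_sub_distrib, ← Finset.sum_add_distrib, ← mul_sub, ← mul_add]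
  refine Finset.sum_le_sum fun d _ => ?_
  refine mul_le_mul_of_nonneg_left ?_ ArithmeticFunction.vonMangoldt_nonneg
  generalize N / d = m
  have : (if 1 ≤ m then 1 else 0 : ℤ) - (if 6 ≤ m then 1 else 0) + (if 7 ≤ m then 1 else 0)
      - (if 10 ≤ m then 1 else 0) ≤ ((m : ℤ) - ((m / 2 : ℕ) : ℤ) - ((m / 3 : ℕ) : ℤ)
        - ((m / 5 : ℕ) : ℤ) + ((m / 30 : ℕ) : ℤ)) := by
    split_ifs <;> omega
  exact_mod_cast this

lemma aux_fact_bounds (n : ℕ) (hn : 1 ≤ n) :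
    n * Real.log n - n ≤ Real.log n.factorial ∧
    Real.log n.factorial ≤ n * Real.log n - n + Real.log n + 1 := by
  induction n, hn using Nat.le_induction with
  | base => simp
  | succ n hn ih =>
    obtain ⟨h1, h2⟩ := ih
    have hn0 : (0 : ℝ) < n := by exact_mod_cast hn
    rw [Nat.factorial_succ, Nat.cast_mul, Real.log_mul (by positivity) (by positivity)]
    push_cast
    have h3 : Real.log (n + 1) - Real.log n ≤ 1 / n := by
      rw [← Real.log_div (by positivity) (by positivity)]
      refine (Real.log_le_sub_one_of_pos (by positivity)).trans (le_of_eq ?_)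
      field_simp; ring
    have h4 : 1 / ((n : ℝ) + 1) ≤ Real.log (n + 1) - Real.log n := by
      have := Real.log_le_sub_one_of_pos (x := (n : ℝ) / (n + 1)) (by positivity)
      rw [Real.log_div (by positivity) (by positivity)] at this
      have h5 : (n : ℝ) / (n + 1) - 1 = - (1 / (n + 1)) := by field_simp; ring
      linarith
    rw [div_le_iff₀ (by positivity)] at h4
    rw [le_div_iff₀ hn0] at h3
    constructor <;> nlinarith

lemma aux_g_mono {x y : ℝ} (hx : 1 ≤ x) (hxy : x ≤ y) :
    x * Real.log x - x ≤ y * Real.log y - y := by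
  have hy : 0 < y := by linarith
  have h2 := Real.log_le_sub_one_of_pos (x := x / y) (by positivity)
  rw [Real.log_div (by positivity) (by positivity)] at h2
  have h4 : x / y * y = x := by field_simp
  have hlx := Real.log_nonneg hx
  have : y * (Real.log x - Real.log y) ≤ x - y := by nlinarith
  nlinarith [mul_nonneg (sub_nonneg.2 hxy) hlx]

lemma auxT_bound (N k : ℕ) (hN : 1 ≤ N) (hk : 1 ≤ k) :
    (N / k : ℝ) * Real.log (N / k : ℝ) - N / k - 2 * √(N : ℝ) ≤ auxT N k ∧
    auxT N k ≤ (N / k : ℝ) * Real.log (N / k : ℝ) - N / k + 2 * √(N : ℝ) := by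
  have hN1 : (1 : ℝ) ≤ N := by exact_mod_cast hN
  have hk1 : (1 : ℝ) ≤ k := by exact_mod_cast hk
  have hE : Real.log (N + 1) + 1 ≤ 2 * √(N : ℝ) := by
    have h1 : Real.log (√(N + 1 : ℝ)) ≤ √(N + 1 : ℝ) - 1 :=
      Real.log_le_sub_one_of_pos (by positivity)
    rw [Real.log_sqrt (by positivity)] at h1
    have h2 : 1 ≤ √(N : ℝ) := Real.one_le_sqrt.2 hN1
    have h3 : √(N + 1 : ℝ) ≤ √(N : ℝ) + 1 / 2 := by
      rw [Real.sqrt_le_left (by positivity)]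
      nlinarith [Real.sq_sqrt (show (0 : ℝ) ≤ N by positivity)]
    linarith
  have hlog0 : 0 ≤ Real.log (N + 1 : ℝ) := Real.log_nonneg (by linarith)
  have hx0 : (0 : ℝ) < N / k := by positivity
  have hnx : ((N / k : ℕ) : ℝ) ≤ N / k := Nat.cast_div_le
  have hxn : (N / k : ℝ) ≤ ((N / k : ℕ) : ℝ) + 1 := by
    rw [div_le_iff₀ (by positivity)]
    have := Nat.lt_mul_div_succ N (show 0 < k by omega)
    have h2 : (N : ℝ) < k * (((N / k : ℕ) : ℝ) + 1) := by exact_mod_cast this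
    linarith
  have hnN : N / k ≤ N := Nat.div_le_self _ _
  unfold auxT
  generalize (N / k : ℝ) = x at *
  generalize N / k = n at *
  have hnN' : (n : ℝ) ≤ N := by exact_mod_cast hnN
  rcases Nat.eq_zero_or_pos n with rfl | hn
  · simp only [Nat.factorial_zero, Nat.cast_one, Real.log_one]
    simp only [Nat.cast_zero, zero_add] at hxn
    have h1 := Real.log_nonpos hx0.le hxn
    have h2 := Real.one_sub_inv_le_log_of_pos hx0
    have h3 : x * x⁻¹ = 1 := by field_simp
    constructor <;> nlinarith
  · have hn1 : (1 : ℝ) ≤ n := by exact_mod_cast hn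
    have h1 := (aux_fact_bounds n hn).2
    have h2 := (aux_fact_bounds (n + 1) (by omega)).1
    rw [Nat.factorial_succ, Nat.cast_mul, Real.log_mul (by positivity) (by positivity)] at h2
    push_cast at h2
    have h3 := aux_g_mono hn1 hnx
    have h4 := aux_g_mono (hn1.trans hnx) hxn
    have h5 : Real.log (n : ℝ) ≤ Real.log (N + 1) :=
      Real.log_le_log (by positivity) (by linarith)
    have h6 : Real.log (n + 1 : ℝ) ≤ Real.log (N + 1) :=
      Real.log_le_log (by positivity) (by linarith)
    constructor <;> linarith

/-- Chebyshev's constant. -/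
noncomputable def auxA : ℝ :=
  7 / 15 * Real.log 2 + 3 / 10 * Real.log 3 + 1 / 6 * Real.log 5

lemma auxA_ge : 0.78 ≤ auxA := by
  have h2 := Real.log_two_gt_d9
  have h3 : 1 ≤ Real.log 3 := by
    rw [Real.le_log_iff_exp_le (by norm_num)]
    linarith [Real.exp_one_lt_d9]
  have h5 : Real.log 3 ≤ Real.log 5 := Real.log_le_log (by norm_num) (by norm_num)
  unfold auxA
  linarith

lemma auxA_le : auxA ≤ 2 := by
  have h2 := Real.log_two_lt_d9
  have h3 := Real.log_le_sub_one_of_pos (show (0 : ℝ) < 3 by norm_num)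
  have h5 := Real.log_le_sub_one_of_pos (show (0 : ℝ) < 5 by norm_num)
  unfold auxA
  linarith

lemma auxS_bound (N : ℕ) : auxA * N - 10 * √(N : ℝ) ≤ auxS N ∧
    auxS N ≤ auxA * N + 10 * √(N : ℝ) := by
  rcases Nat.eq_zero_or_pos N with rfl | hN
  · simp [auxS, auxT]
  have hN0 : (0 : ℝ) < N := by exact_mod_cast hN
  have h1 := auxT_bound N 1 hN (by norm_num)
  have h2 := auxT_bound N 2 hN (by norm_num)
  have h3 := auxT_bound N 3 hN (by norm_num)
  have h5 := auxT_bound N 5 hN (by norm_num)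
  have h30 := auxT_bound N 30 hN (by norm_num)
  rw [Real.log_div (by positivity) (by norm_num)] at h1 h2 h3 h5 h30
  have h : Real.log ((30 : ℕ) : ℝ) = Real.log 2 + Real.log 3 + Real.log 5 := by
    rw [← Real.log_mul (by norm_num) (by norm_num), ← Real.log_mul (by norm_num) (by norm_num)]
    norm_num
  rw [h] at h30
  push_cast at h1 h2 h3 h5 h30
  rw [Real.log_one] at h1
  unfold auxS auxA
  constructor <;> linarith

lemma aux_psi_ge (N : ℕ) : auxA * N - 10 * √(N : ℝ) ≤ Chebyshev.psi (N : ℝ) :=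
  (auxS_bound N).1.trans (auxS_le N)

lemma aux_sqrt_div (N k : ℕ) (c : ℝ) (hc : 0 ≤ c) (h : 1 ≤ c ^ 2 * k) (hk : 0 < k) :
    √((N / k : ℕ) : ℝ) ≤ c * √(N : ℝ) := by
  rw [Real.sqrt_le_left (by positivity), mul_pow, Real.sq_sqrt (by positivity)]
  refine Nat.cast_div_le.trans ?_
  have hk0 : (0 : ℝ) < k := by exact_mod_cast hk
  rw [div_le_iff₀ hk0]
  nlinarith [show (0 : ℝ) ≤ N by positivity]

lemma aux_psi_le (N : ℕ) : Chebyshev.psi (N : ℝ) ≤ 90 / 77 * auxA * N + 60 * √(N : ℝ) := by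
  induction N using Nat.strong_induction_on with
  | _ N ih =>
    rcases Nat.eq_zero_or_pos N with rfl | hN
    · simp
    have hN1 : (1 : ℝ) ≤ N := by exact_mod_cast hN
    have hs : 1 ≤ √(N : ℝ) := Real.one_le_sqrt.2 hN1
    have h6 := ih (N / 6) (by omega)
    have h10 := ih (N / 10) (by omega)
    have h7 := aux_psi_ge (N / 7)
    have hS := (auxS_ge N).trans (auxS_bound N).2
    have s6 := aux_sqrt_div N 6 0.409 (by norm_num) (by norm_num) (by norm_num)
    have s7 := aux_sqrt_div N 7 0.4 (by norm_num) (by norm_num) (by norm_num)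
    have s10 := aux_sqrt_div N 10 0.317 (by norm_num) (by norm_num) (by norm_num)
    have n6 : ((N / 6 : ℕ) : ℝ) ≤ N / 6 := Nat.cast_div_le
    have n10 : ((N / 10 : ℕ) : ℝ) ≤ N / 10 := Nat.cast_div_le
    have n7 : (N : ℝ) / 7 - 1 ≤ ((N / 7 : ℕ) : ℝ) := by
      have : N ≤ 7 * (N / 7) + 7 := by omega
      have : (N : ℝ) ≤ 7 * ((N / 7 : ℕ) : ℝ) + 7 := by exact_mod_cast this
      linarith
    have hA := auxA_ge
    have hA0 : 0 ≤ auxA := by linarith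
    have hA2 := auxA_le
    have m6 := mul_le_mul_of_nonneg_left n6 hA0
    have m7 := mul_le_mul_of_nonneg_left n7 hA0
    have m10 := mul_le_mul_of_nonneg_left n10 hA0
    linarith

lemma aux_psi_sub_theta (x : ℝ) (h : 1 ≤ x) :
    Chebyshev.psi x - Chebyshev.theta x ≤ 17 * √x := by
  have h4 : Real.log 4 ≤ 1.4 := by
    rw [show (4 : ℝ) = 2 ^ 2 by norm_num, Real.log_pow]
    have := Real.log_two_lt_d9
    push_cast
    linarith
  have key (n : ℝ) (hn : 2 ≤ n) : Chebyshev.psi (x ^ n⁻¹) ≤ 5.4 * √x := by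
    have h1 := Chebyshev.psi_le_const_mul_self (x := x ^ n⁻¹) (by positivity)
    have h2 : x ^ n⁻¹ ≤ √x := by
      rw [Real.sqrt_eq_rpow x]
      apply Real.rpow_le_rpow_of_exponent_le h
      rw [one_div]
      gcongr
    have h3 : 0 ≤ x ^ n⁻¹ := by positivity
    nlinarith
  have := Real.sqrt_nonneg x
  linarith [Chebyshev.psi_sub_theta_le_psi_add_psi_add_psi x, key 2 le_rfl, key 3 (by norm_num),
    key 5 (by norm_num)]

lemma aux_large (p : ℕ) (hp : 20000000 ≤ p) : ∃ r, r.Prime ∧ p < r ∧ 5 * (r - 1) < 6 * (p - 1) := by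
  obtain ⟨M, hM⟩ : ∃ M, M = (6 * p - 2) / 5 := ⟨_, rfl⟩
  have hM1 : 6 * p ≤ 5 * M + 6 := by omega
  have hM2 : 5 * M + 2 ≤ 6 * p := by omega
  have hM1' : 6 * (p : ℝ) ≤ 5 * M + 6 := by exact_mod_cast hM1
  have hM2' : 5 * (M : ℝ) + 2 ≤ 6 * p := by exact_mod_cast hM2
  have hp' : (20000000 : ℝ) ≤ p := by exact_mod_cast hp
  have hlt : Chebyshev.theta (p : ℝ) < Chebyshev.theta (M : ℝ) := by
    have h1 := (Chebyshev.theta_le_psi (p : ℝ)).trans (aux_psi_le p)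
    have h2 := aux_psi_ge M
    have h3 := aux_psi_sub_theta M (by linarith)
    have hsM : √(M : ℝ) ≤ 1.1 * √(p : ℝ) := by
      rw [Real.sqrt_le_left (by positivity), mul_pow, Real.sq_sqrt (by positivity)]
      linarith
    have hs : 4400 ≤ √(p : ℝ) := Real.le_sqrt_of_sq_le (by linarith)
    have hsq : √(p : ℝ) * √(p : ℝ) = p := Real.mul_self_sqrt (by positivity)
    have hA := auxA_ge
    have hA2 := auxA_le
    have hp4 : 4400 * √(p : ℝ) ≤ p := by nlinarith
    have m1 : auxA * ((6 * p - 6) / 5) ≤ auxA * M :=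
      mul_le_mul_of_nonneg_left (by linarith) (by linarith)
    have m2 : 0.78 * (p : ℝ) ≤ auxA * p := mul_le_mul_of_nonneg_right hA (by linarith)
    linarith
  by_contra! hcon
  refine absurd hlt (not_lt.2 ?_)
  unfold Chebyshev.theta
  rw [Nat.floor_natCast, Nat.floor_natCast]
  apply Finset.sum_le_sum_of_subset_of_nonneg
  · intro r hr
    simp only [Finset.mem_filter, Finset.mem_Ioc] at hr ⊢
    refine ⟨⟨hr.1.1, ?_⟩, hr.2⟩
    by_contra! hlt'
    have := hcon r hr.2 hlt'
    omega
  · intro r _ _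
    exact Real.log_natCast_nonneg r

lemma aux_chain (l : List ℕ) (a p : ℕ) (hl : ∀ r ∈ l, r.Prime)
    (hc : List.IsChain (fun x y => 5 * y + 2 ≤ 6 * x) (a :: l)) (ha : a ≤ p)
    (hp : ∃ r ∈ l, p < r) : ∃ r, r.Prime ∧ p < r ∧ 5 * (r - 1) < 6 * (p - 1) := by
  induction l generalizing a with
  | nil => simp at hp
  | cons b l ih =>
    rw [List.isChain_cons_cons] at hc
    by_cases hb : p < b
    · exact ⟨b, hl b (by simp), hb, by omega⟩
    · refine ih b (fun r hr => hl r (by simp [hr])) hc.2 (by omega) ?_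
      obtain ⟨r, hr, hpr⟩ := hp
      rcases List.mem_cons.1 hr with rfl | h
      · omega
      · exact ⟨r, h, hpr⟩

lemma aux_small (p : ℕ) (hp : 37 ≤ p) (hp2 : p < 20000000) :
    ∃ r, r.Prime ∧ p < r ∧ 5 * (r - 1) < 6 * (p - 1) := by
  refine aux_chain [43, 47, 53, 61, 71, 83, 97, 113, 131, 151, 179, 211, 251, 293, 349, 409, 487, 577, 691,
      827, 991, 1187, 1423, 1699, 2029, 2423, 2903, 3469, 4159, 4987, 5981, 7159, 8581, 10289,
      12343, 14797, 17749, 21283, 25537, 30643, 36767, 44119, 52937, 63521, 76213, 91453,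
      109741, 131687, 158017, 189619, 227537, 273043, 327647, 393161, 471791, 566131, 679333,
      815197, 978233, 1173853, 1408621, 1690319, 2028373, 2434037, 2920837, 3504997, 4205989,
      5047171, 6056581, 7267889, 8721443, 10465729, 12558811, 15070529, 18084629, 21701551] 37 p ?_ ?_ hp ⟨21701551, by simp, by omega⟩
  · simp only [List.forall_mem_cons]
    norm_num
  · simp

/-- If `p < q` are consecutive primes with `q > 37` and `k` is an even integer
with `p < k < q`, then `k − 2 ≥ p − 1` and `5·(q − 1) < 6·(k − 2)`. -/
theorem even_between_consecutive_primes (p q k : ℕ) (hpq : ConsecutivePrimes p q)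
    (hq : q > 37) (hk : Even k) (hpk : p < k) (hkq : k < q) :
    k - 2 ≥ p - 1 ∧ 5 * (q - 1) < 6 * (k - 2) := by
  obtain ⟨hp, hqp, hlt, hmin⟩ := hpq
  have h37 : 37 ≤ p := by
    by_contra! h
    have := hmin 37 (by norm_num) h
    omega
  have hodd : Odd p := hp.odd_of_ne_two (by omega)
  obtain ⟨a, ha⟩ := hodd
  obtain ⟨r, hr, hpr, hb⟩ : ∃ r, r.Prime ∧ p < r ∧ 5 * (r - 1) < 6 * (p - 1) := by
    rcases lt_or_ge p 20000000 with h | h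
    · exact aux_small p h37 h
    · exact aux_large p h
  have := hmin r hr hpr
  omega
end

section
/- Let a and b be positive integers with a > b and 5·a < 6·b. Then a / gcd(a, b) ≥ 7. -/
/-- If `a` and `b` are positive integers with `a > b` and `5·a < 6·b`,
then `a / gcd(a, b) ≥ 7`. -/
theorem div_gcd_ge_seven (a b : ℕ) (ha : 0 < a) (hb : 0 < b) (hab : a > b)
    (h : 5 * a < 6 * b) : a / Nat.gcd a b ≥ 7 := by
  have hg : 0 < Nat.gcd a b := Nat.gcd_pos_of_pos_left b ha
  obtain ⟨x, hx⟩ := Nat.gcd_dvd_left a b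
  obtain ⟨y, hy⟩ := Nat.gcd_dvd_right a b
  generalize Nat.gcd a b = g at *
  subst hx hy
  rw [Nat.mul_div_cancel_left x hg]
  have h1 : y < x := Nat.lt_of_mul_lt_mul_left hab
  have h2 : 5 * x < 6 * y := by
    apply Nat.lt_of_mul_lt_mul_left (a := g)
    linarith
  omega
end

section
/- Let p < q be consecutive primes with q > 37, and let k be an even integer with p < k < q. Set d = gcd(q − 1, k − 2), m = (q − 1)/d, and define t by: t = (m+1)/2 if m is odd, t = m/2 + 2 if m ≡ 2 (mod 4), and t = m/2 + 1 if m ≡ 0 (mod 4). Then m ≥ 7, gcd(t, m) = 1, and both d·t + 2 < p and q + 1 − d·t < p; in particular both values are strictly smaller than k. -/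
/-- `tOf m` is `(m+1)/2` if `m` is odd, `m/2 + 2` if `m ≡ 2 (mod 4)`,
and `m/2 + 1` if `m ≡ 0 (mod 4)`. -/
def tOf (m : ℕ) : ℕ :=
  if m % 2 = 1 then (m + 1) / 2
  else if m % 4 = 2 then m / 2 + 2
  else m / 2 + 1

open ArithmeticFunction in
lemma wr_logfac (N M : ℕ) (h : N ≤ M) :
    Real.log (N.factorial : ℝ) = ∑ d ∈ Finset.Ioc 0 M, vonMangoldt d * ((N / d : ℕ) : ℝ) := by
  induction N with
  | zero => simp
  | succ n ih =>
    have ih' := ih (by omega)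
    rw [Nat.factorial_succ, Nat.cast_mul, Real.log_mul (by positivity) (by positivity), ih',
      ← vonMangoldt_sum]
    have h1 : ∑ i ∈ (n+1).divisors, vonMangoldt i
        = ∑ d ∈ Finset.Ioc 0 M, vonMangoldt d * (if d ∣ n + 1 then 1 else 0) := by
      simp only [mul_ite, mul_one, mul_zero]
      rw [← Finset.sum_filter]
      apply Finset.sum_congr _ (fun _ _ => rfl)
      ext d
      simp only [Nat.mem_divisors, Finset.mem_filter, Finset.mem_Ioc]
      constructor
      · rintro ⟨h1, _⟩
        have := Nat.le_of_dvd (by omega) h1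
        have := Nat.pos_of_dvd_of_pos h1 (by omega)
        exact ⟨⟨by omega, by omega⟩, h1⟩
      · rintro ⟨_, h1⟩
        exact ⟨h1, by omega⟩
    rw [h1, ← Finset.sum_add_distrib]
    apply Finset.sum_congr rfl
    intro d _
    rw [← mul_add, Nat.succ_div]
    split_ifs <;> push_cast <;> ring

open ArithmeticFunction in
/-- the Chebyshev function on naturals -/
noncomputable def wrP (N : ℕ) : ℝ := ∑ d ∈ Finset.Ioc 0 N, vonMangoldt d

lemma wrP_eq (N : ℕ) : Chebyshev.psi (N : ℝ) = wrP N := by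
  simp [Chebyshev.psi, wrP]

open ArithmeticFunction in
lemma wrP_div (N k : ℕ) (hk : 0 < k) :
    wrP (N / k) = ∑ d ∈ Finset.Ioc 0 N, vonMangoldt d * (if k ≤ N / d then 1 else 0) := by
  unfold wrP
  simp only [mul_ite, mul_one, mul_zero]
  rw [← Finset.sum_filter]
  apply Finset.sum_congr _ (fun _ _ => rfl)
  ext d
  simp only [Finset.mem_filter, Finset.mem_Ioc]
  constructor
  · rintro ⟨h1, h2⟩
    have h3 := (Nat.le_div_iff_mul_le hk).1 h2
    refine ⟨⟨h1, by nlinarith⟩, (Nat.le_div_iff_mul_le h1).2 (by linarith)⟩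
  · rintro ⟨⟨h1, _⟩, h2⟩
    have h3 := (Nat.le_div_iff_mul_le h1).1 h2
    exact ⟨h1, (Nat.le_div_iff_mul_le hk).2 (by linarith)⟩

/-- log factorial -/
noncomputable def wrT (N : ℕ) : ℝ := Real.log (N.factorial : ℝ)

/-- Chebyshev's combination -/
noncomputable def wrF (N : ℕ) : ℝ :=
  wrT N - wrT (N / 2) - wrT (N / 3) - wrT (N / 5) + wrT (N / 30)

open ArithmeticFunction in
lemma wrF_eq (N : ℕ) : wrF N = ∑ d ∈ Finset.Ioc 0 N, vonMangoldt d *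
    (((N / d : ℕ) : ℝ) - ((N / d / 2 : ℕ) : ℝ) - ((N / d / 3 : ℕ) : ℝ) - ((N / d / 5 : ℕ) : ℝ)
      + ((N / d / 30 : ℕ) : ℝ)) := by
  unfold wrF wrT
  rw [wr_logfac N N le_rfl, wr_logfac (N/2) N (Nat.div_le_self _ _),
    wr_logfac (N/3) N (Nat.div_le_self _ _), wr_logfac (N/5) N (Nat.div_le_self _ _),
    wr_logfac (N/30) N (Nat.div_le_self _ _), ← Finset.sum_sub_distrib, ← Finset.sum_sub_distrib,
    ← Finset.sum_sub_distrib, ← Finset.sum_add_distrib]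
  apply Finset.sum_congr rfl
  intro d _
  rw [Nat.div_right_comm N 2 d, Nat.div_right_comm N 3 d, Nat.div_right_comm N 5 d,
    Nat.div_right_comm N 30 d]
  ring

lemma wrF_le (N : ℕ) : wrF N ≤ wrP N := by
  rw [wrF_eq, wrP]
  apply Finset.sum_le_sum
  intro d _
  have h0 : 0 ≤ ArithmeticFunction.vonMangoldt d := ArithmeticFunction.vonMangoldt_nonneg
  generalize N / d = u
  have h : u + u / 30 ≤ 1 + u / 2 + u / 3 + u / 5 := by omega
  have h' : (u : ℝ) + (u / 30 : ℕ) ≤ 1 + (u / 2 : ℕ) + (u / 3 : ℕ) + (u / 5 : ℕ) := by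
    exact_mod_cast h
  nlinarith

lemma wrF_ge (N : ℕ) : wrP N - wrP (N / 6) + wrP (N / 7) - wrP (N / 10) ≤ wrF N := by
  have h1 := wrP_div N 1 one_pos
  rw [Nat.div_one] at h1
  rw [wrF_eq, h1, wrP_div N 6 (by norm_num), wrP_div N 7 (by norm_num), wrP_div N 10 (by norm_num),
    ← Finset.sum_sub_distrib, ← Finset.sum_add_distrib, ← Finset.sum_sub_distrib]
  apply Finset.sum_le_sum
  intro d _
  have h0 : 0 ≤ ArithmeticFunction.vonMangoldt d := ArithmeticFunction.vonMangoldt_nonneg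
  rw [← mul_sub, ← mul_add, ← mul_sub]
  apply mul_le_mul_of_nonneg_left _ h0
  generalize N / d = u
  have h : (if 1 ≤ u then 1 else 0) + (if 7 ≤ u then 1 else 0) + u / 2 + u / 3 + u / 5
      ≤ u + u / 30 + (if 6 ≤ u then 1 else 0) + (if 10 ≤ u then 1 else 0) := by
    split_ifs <;> omega
  have h' : ((if 1 ≤ u then 1 else 0) : ℝ) + (if 7 ≤ u then 1 else 0) + (u / 2 : ℕ) + (u / 3 : ℕ)
      + (u / 5 : ℕ)
      ≤ u + (u / 30 : ℕ) + (if 6 ≤ u then 1 else 0) + (if 10 ≤ u then 1 else 0) := by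
    exact_mod_cast h
  linarith

lemma wr_one_sub_le (a b : ℝ) (ha : 0 < a) (hb : 0 < b) :
    b - a ≤ b * (Real.log b - Real.log a) := by
  have h := Real.log_le_sub_one_of_pos (div_pos ha hb)
  rw [Real.log_div ha.ne' hb.ne'] at h
  have : b * (a / b) = a := by field_simp
  nlinarith

lemma wrT_bounds (n : ℕ) : 
    ((n : ℝ) + 1) * Real.log (n + 1) - (n + 1) + 1 ≤ wrT (n + 1) ∧
    wrT (n + 1) ≤ ((n : ℝ) + 1) * Real.log (n + 1) - (n + 1) + 1 + Real.log (n + 1) := by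
  unfold wrT
  induction n with
  | zero => simp
  | succ n ih =>
    obtain ⟨h1, h2⟩ := ih
    rw [Nat.factorial_succ (n + 1), Nat.cast_mul, Real.log_mul (by positivity) (by positivity)]
    push_cast
    have e1 := wr_one_sub_le ((n : ℝ) + 1) (n + 1 + 1) (by positivity) (by positivity)
    have e2 := wr_one_sub_le ((n : ℝ) + 1 + 1) (n + 1) (by positivity) (by positivity)
    constructor <;> nlinarith

lemma wr_mono (a b : ℝ) (ha : 1 ≤ a) (hab : a ≤ b) :
    a * Real.log a - a ≤ b * Real.log b - b := by
  have e1 := wr_one_sub_le a b (by linarith) (by linarith)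
  have := Real.log_nonneg ha
  nlinarith

lemma wrT_real (n : ℕ) (x : ℝ) (hx : 1 ≤ x) (h1 : (n : ℝ) ≤ x) (h2 : x < n + 1) :
    x * Real.log x - x - Real.log x - 1 ≤ wrT n ∧
    wrT n ≤ x * Real.log x - x + Real.log x + 1 := by
  obtain ⟨k, rfl⟩ : ∃ k, n = k + 1 := by
    rcases n with _ | k
    · norm_num at h2; linarith
    · exact ⟨k, rfl⟩
  push_cast at h1 h2
  constructor
  · have b := (wrT_bounds (k + 1)).1
    have e : wrT (k + 1 + 1) = Real.log (k + 1 + 1) + wrT (k + 1) := by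
      unfold wrT
      rw [Nat.factorial_succ (k + 1), Nat.cast_mul, Real.log_mul (by positivity) (by positivity)]
      push_cast; rfl
    rw [e] at b
    push_cast at b
    have m := wr_mono x (k + 1 + 1) hx h2.le
    have l : Real.log ((k : ℝ) + 1 + 1) ≤ Real.log (2 * x) :=
      Real.log_le_log (by positivity) (by linarith)
    rw [Real.log_mul (by norm_num) (by linarith)] at l
    have := Real.log_two_lt_d9
    linarith
  · have b := (wrT_bounds k).2
    have m := wr_mono (k + 1) x (by linarith [(Nat.cast_nonneg k : (0:ℝ) ≤ k)]) h1
    have l : Real.log ((k : ℝ) + 1) ≤ Real.log x := Real.log_le_log (by positivity) h1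
    linarith

lemma wrT_div (N k : ℕ) (hk : 0 < k) (h : k ≤ N) :
    |wrT (N / k) - ((N / k : ℝ) * (Real.log N - Real.log k) - (N / k : ℝ))|
      ≤ Real.log N + 1 := by
  have hk' : (0 : ℝ) < k := by exact_mod_cast hk
  have hN' : (0 : ℝ) < N := by exact_mod_cast (lt_of_lt_of_le hk h)
  have a1 : (1 : ℝ) ≤ (N : ℝ) / k := by
    rw [le_div_iff₀ hk']; simpa using (by exact_mod_cast h : (k : ℝ) ≤ N)
  have a2 : ((N / k : ℕ) : ℝ) ≤ (N : ℝ) / k := Nat.cast_div_le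
  have a3 : (N : ℝ) / k < ((N / k : ℕ) : ℝ) + 1 := by
    rw [div_lt_iff₀ hk']
    have := Nat.lt_div_mul_add (a := N) hk
    have h' : (N : ℝ) < (N / k : ℕ) * k + k := by exact_mod_cast this
    linarith
  have b := wrT_real (N / k) (N / k : ℝ) a1 a2 a3
  rw [Real.log_div hN'.ne' hk'.ne'] at b
  have : 0 ≤ Real.log k := Real.log_natCast_nonneg k
  rw [abs_le]
  constructor <;> linarith [b.1, b.2]

/-- Chebyshev's constant -/
noncomputable def wrA : ℝ := 7 / 15 * Real.log 2 + 3 / 10 * Real.log 3 + 1 / 6 * Real.log 5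

lemma wrA_gt : 0.89 < wrA := by
  have h3 : Real.log ((2:ℝ) ^ 3) ≤ Real.log ((3:ℝ) ^ 2) := Real.log_le_log (by norm_num) (by norm_num)
  have h5 : Real.log ((2:ℝ) ^ 9) ≤ Real.log ((5:ℝ) ^ 4) := Real.log_le_log (by norm_num) (by norm_num)
  rw [Real.log_pow, Real.log_pow] at h3 h5
  push_cast at h3 h5
  have := Real.log_two_gt_d9
  unfold wrA
  linarith

lemma wrA_lt : wrA < 1 := by
  have h3 : Real.log ((3:ℝ) ^ 5) ≤ Real.log ((2:ℝ) ^ 8) := Real.log_le_log (by norm_num) (by norm_num)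
  have h5 : Real.log ((5:ℝ) ^ 3) ≤ Real.log ((2:ℝ) ^ 7) := Real.log_le_log (by norm_num) (by norm_num)
  rw [Real.log_pow, Real.log_pow] at h3 h5
  push_cast at h3 h5
  have := Real.log_two_lt_d9
  unfold wrA
  linarith

lemma wrF_bound (N : ℕ) (h : 30 ≤ N) : |wrF N - wrA * N| ≤ 5 * Real.log N + 5 := by
  have t1 := wrT_div N 1 (by norm_num) (by omega)
  have t2 := wrT_div N 2 (by norm_num) (by omega)
  have t3 := wrT_div N 3 (by norm_num) (by omega)
  have t5 := wrT_div N 5 (by norm_num) (by omega)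
  have t30 := wrT_div N 30 (by norm_num) (by omega)
  have e : Real.log 30 = Real.log 2 + Real.log 3 + Real.log 5 := by
    rw [← Real.log_mul (by norm_num) (by norm_num), ← Real.log_mul (by norm_num) (by norm_num)]
    norm_num
  rw [Nat.div_one] at t1
  simp only [Nat.cast_one, Nat.cast_ofNat, Real.log_one, e] at t1 t2 t3 t5 t30
  rw [abs_le] at *
  unfold wrF wrA
  obtain ⟨a1, b1⟩ := t1
  obtain ⟨a2, b2⟩ := t2
  obtain ⟨a3, b3⟩ := t3
  obtain ⟨a5, b5⟩ := t5
  obtain ⟨a30, b30⟩ := t30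
  constructor <;> nlinarith

lemma wrP_lower (N : ℕ) (h : 30 ≤ N) : wrA * N - 5 * Real.log N - 5 ≤ wrP N := by
  have := (abs_le.1 (wrF_bound N h)).1
  linarith [wrF_le N]

lemma wr_log_sqrt (N : ℕ) (hN : 1 ≤ N) : Real.log N ≤ Real.sqrt N := by
  have hN' : (1 : ℝ) ≤ N := by exact_mod_cast hN
  have hs : 0 < Real.sqrt N := Real.sqrt_pos.2 (by linarith)
  have h := Real.log_le_sub_one_of_pos (half_pos hs)
  rw [Real.log_div hs.ne' (by norm_num), Real.log_sqrt (by linarith)] at h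
  have := Real.log_two_lt_d9
  linarith

lemma wr_sqrt_div (N k : ℕ) (c : ℝ) (hc : 0 ≤ c) (hk : 0 < k) (h : 1 ≤ c ^ 2 * k) :
    Real.sqrt ((N / k : ℕ) : ℝ) ≤ c * Real.sqrt N := by
  have hk' : (0 : ℝ) < k := by exact_mod_cast hk
  rw [← Real.sqrt_sq hc, ← Real.sqrt_mul (by positivity)]
  apply Real.sqrt_le_sqrt
  refine Nat.cast_div_le.trans ?_
  rw [div_le_iff₀ hk']
  nlinarith [(Nat.cast_nonneg N : (0:ℝ) ≤ N)]

lemma wrP_upper (N : ℕ) : wrP N ≤ 1.17 * wrA * N + 80 * Real.sqrt N := by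
  induction N using Nat.strong_induction_on with
  | _ N ih =>
  have hA := wrA_gt
  have hA' := wrA_lt
  have hs0 := Real.sqrt_nonneg (N : ℝ)
  have hss := Real.mul_self_sqrt (Nat.cast_nonneg N : (0:ℝ) ≤ N)
  by_cases hN : N < 210
  · have h1 := Chebyshev.psi_le_const_mul_self (Nat.cast_nonneg N : (0:ℝ) ≤ N)
    rw [wrP_eq] at h1
    have h4 : Real.log 4 ≤ 1.4 := by
      rw [show (4:ℝ) = 2 ^ 2 by norm_num, Real.log_pow]
      have := Real.log_two_lt_d9
      push_cast; linarith
    have hs : Real.sqrt N ≤ 14.5 := by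
      rw [Real.sqrt_le_left (by norm_num)]
      have : (N : ℝ) < 210 := by exact_mod_cast hN
      linarith
    have hNn : (0:ℝ) ≤ N := Nat.cast_nonneg N
    have h2 : (Real.log 4 + 4) * N ≤ 5.4 * N := by nlinarith
    have h3 : 5.4 * (N:ℝ) ≤ 80 * Real.sqrt N := by nlinarith
    have h5 : 0 ≤ 1.17 * wrA * N := by positivity
    linarith
  · push Not at hN
    have i6 := ih (N / 6) (by omega)
    have i10 := ih (N / 10) (by omega)
    have l7 := wrP_lower (N / 7) (by omega)
    have f := wrF_ge N
    have fb := (abs_le.1 (wrF_bound N (by omega))).2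
    have s6 := wr_sqrt_div N 6 0.41 (by norm_num) (by norm_num) (by norm_num)
    have s10 := wr_sqrt_div N 10 0.32 (by norm_num) (by norm_num) (by norm_num)
    have ll : Real.log ((N / 7 : ℕ) : ℝ) ≤ Real.log N := 
      Real.log_le_log (by exact_mod_cast (by omega : 0 < N / 7))
        (by exact_mod_cast Nat.div_le_self _ _)
    have lN := wr_log_sqrt N (by omega)
    have d6 : ((N / 6 : ℕ) : ℝ) ≤ (N : ℝ) / 6 := by exact_mod_cast Nat.cast_div_le (α := ℝ) (m := N) (n := 6)
    have d10 : ((N / 10 : ℕ) : ℝ) ≤ (N : ℝ) / 10 := by exact_mod_cast Nat.cast_div_le (α := ℝ) (m := N) (n := 10)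
    have d7 : (N : ℝ) / 7 - 1 ≤ ((N / 7 : ℕ) : ℝ) := by
      have : N ≤ 7 * (N / 7) + 7 := by omega
      have h' : (N : ℝ) ≤ 7 * (N / 7 : ℕ) + 7 := by exact_mod_cast this
      linarith
    have hNr : (210 : ℝ) ≤ N := by exact_mod_cast hN
    have hs : 14 ≤ Real.sqrt N := Real.le_sqrt_of_sq_le (by linarith)
    have m6 := mul_le_mul_of_nonneg_left d6 (by linarith : 0 ≤ wrA)
    have m10 := mul_le_mul_of_nonneg_left d10 (by linarith : 0 ≤ wrA)
    have m7 := mul_le_mul_of_nonneg_left d7 (by linarith : 0 ≤ wrA)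
    have mN : 0 ≤ wrA * N := mul_nonneg (by linarith) (by linarith)
    linarith

lemma wr_large (p : ℕ) (hp : 100000000 ≤ p) : ∃ r, r.Prime ∧ p < r ∧ 5 * r + 1 < 6 * p := by
  by_contra! hno
  obtain ⟨N, hN⟩ : ∃ N, N = (6 * p - 2) / 5 := ⟨_, rfl⟩
  have hA := wrA_gt
  have hA' := wrA_lt
  have hth : Chebyshev.theta (N : ℝ) ≤ Chebyshev.theta (p : ℝ) := by
    unfold Chebyshev.theta
    apply Finset.sum_le_sum_of_subset_of_nonneg
    · intro r
      simp only [Nat.floor_natCast, Finset.mem_filter, Finset.mem_Ioc]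
      rintro ⟨⟨h1, h2⟩, h3⟩
      refine ⟨⟨h1, ?_⟩, h3⟩
      by_contra! h4
      have := hno r h3 h4
      omega
    · intro r _ _
      exact Real.log_natCast_nonneg r
  have u := wrP_upper p
  have l := wrP_lower N (by omega)
  have tp := Chebyshev.theta_le_psi (p : ℝ)
  have hN1 : (1 : ℝ) ≤ N := by exact_mod_cast (by omega : 1 ≤ N)
  have tN := Chebyshev.psi_sub_theta_le hN1
  rw [wrP_eq] at tp tN
  have hpr : (100000000 : ℝ) ≤ p := by exact_mod_cast hp
  have hNl : 6 * (p : ℝ) ≤ 5 * N + 6 := by exact_mod_cast (by omega : 6 * p ≤ 5 * N + 6)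
  have hNu : 5 * (N : ℝ) ≤ 6 * p := by exact_mod_cast (by omega : 5 * N ≤ 6 * p)
  obtain ⟨s, hs⟩ : ∃ s, s = Real.sqrt p := ⟨_, rfl⟩
  have hss : s * s = p := by rw [hs]; exact Real.mul_self_sqrt (by linarith)
  have hs4 : 10000 ≤ s := by rw [hs]; exact Real.le_sqrt_of_sq_le (by linarith)
  have hsN : Real.sqrt N ≤ 1.1 * s := by
    rw [Real.sqrt_le_left (by linarith)]
    nlinarith
  have hsN0 : 0 < Real.sqrt N := Real.sqrt_pos.2 (by linarith)
  have hL : Real.log N ≤ s / 3000 + 16.1 := by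
    have h := Real.log_le_sub_one_of_pos (div_pos hsN0 (by norm_num : (0:ℝ) < 2 ^ 13))
    rw [Real.log_div hsN0.ne' (by norm_num), Real.log_sqrt (by linarith), Real.log_pow] at h
    have := Real.log_two_lt_d9
    push_cast at h
    linarith
  have hL0 : 0 ≤ Real.log N := Real.log_natCast_nonneg N
  have hprod : 2 * Real.sqrt N * Real.log N ≤ 2 * (1.1 * s) * (s / 3000 + 16.1) := by
    gcongr
  rw [← hs] at u
  have hAN : wrA * (6 / 5 * p - 6 / 5) ≤ wrA * N :=
    mul_le_mul_of_nonneg_left (by linarith) (by linarith)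
  have hAp : 0.89 * (0.03 * p) ≤ wrA * (0.03 * (p:ℝ)) := by
    apply mul_le_mul_of_nonneg_right hA.le (by linarith)
  nlinarith

lemma wr_gap (p : ℕ) (hp : 37 ≤ p) : ∃ r, r.Prime ∧ p < r ∧ 5 * r + 1 < 6 * p := by
  by_cases h0 : p < 43
  · exact ⟨43, by norm_num, h0, by omega⟩
  by_cases h1 : p < 47
  · exact ⟨47, by norm_num, h1, by omega⟩
  by_cases h2 : p < 53
  · exact ⟨53, by norm_num, h2, by omega⟩
  by_cases h3 : p < 61
  · exact ⟨61, by norm_num, h3, by omega⟩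
  by_cases h4 : p < 71
  · exact ⟨71, by norm_num, h4, by omega⟩
  by_cases h5 : p < 83
  · exact ⟨83, by norm_num, h5, by omega⟩
  by_cases h6 : p < 97
  · exact ⟨97, by norm_num, h6, by omega⟩
  by_cases h7 : p < 113
  · exact ⟨113, by norm_num, h7, by omega⟩
  by_cases h8 : p < 131
  · exact ⟨131, by norm_num, h8, by omega⟩
  by_cases h9 : p < 151
  · exact ⟨151, by norm_num, h9, by omega⟩
  by_cases h10 : p < 179
  · exact ⟨179, by norm_num, h10, by omega⟩
  by_cases h11 : p < 211
  · exact ⟨211, by norm_num, h11, by omega⟩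
  by_cases h12 : p < 251
  · exact ⟨251, by norm_num, h12, by omega⟩
  by_cases h13 : p < 293
  · exact ⟨293, by norm_num, h13, by omega⟩
  by_cases h14 : p < 349
  · exact ⟨349, by norm_num, h14, by omega⟩
  by_cases h15 : p < 409
  · exact ⟨409, by norm_num, h15, by omega⟩
  by_cases h16 : p < 487
  · exact ⟨487, by norm_num, h16, by omega⟩
  by_cases h17 : p < 577
  · exact ⟨577, by norm_num, h17, by omega⟩
  by_cases h18 : p < 691
  · exact ⟨691, by norm_num, h18, by omega⟩
  by_cases h19 : p < 827
  · exact ⟨827, by norm_num, h19, by omega⟩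
  by_cases h20 : p < 991
  · exact ⟨991, by norm_num, h20, by omega⟩
  by_cases h21 : p < 1187
  · exact ⟨1187, by norm_num, h21, by omega⟩
  by_cases h22 : p < 1423
  · exact ⟨1423, by norm_num, h22, by omega⟩
  by_cases h23 : p < 1699
  · exact ⟨1699, by norm_num, h23, by omega⟩
  by_cases h24 : p < 2029
  · exact ⟨2029, by norm_num, h24, by omega⟩
  by_cases h25 : p < 2423
  · exact ⟨2423, by norm_num, h25, by omega⟩
  by_cases h26 : p < 2903
  · exact ⟨2903, by norm_num, h26, by omega⟩
  by_cases h27 : p < 3469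
  · exact ⟨3469, by norm_num, h27, by omega⟩
  by_cases h28 : p < 4159
  · exact ⟨4159, by norm_num, h28, by omega⟩
  by_cases h29 : p < 4987
  · exact ⟨4987, by norm_num, h29, by omega⟩
  by_cases h30 : p < 5981
  · exact ⟨5981, by norm_num, h30, by omega⟩
  by_cases h31 : p < 7159
  · exact ⟨7159, by norm_num, h31, by omega⟩
  by_cases h32 : p < 8581
  · exact ⟨8581, by norm_num, h32, by omega⟩
  by_cases h33 : p < 10289
  · exact ⟨10289, by norm_num, h33, by omega⟩
  by_cases h34 : p < 12343
  · exact ⟨12343, by norm_num, h34, by omega⟩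
  by_cases h35 : p < 14797
  · exact ⟨14797, by norm_num, h35, by omega⟩
  by_cases h36 : p < 17749
  · exact ⟨17749, by norm_num, h36, by omega⟩
  by_cases h37 : p < 21283
  · exact ⟨21283, by norm_num, h37, by omega⟩
  by_cases h38 : p < 25537
  · exact ⟨25537, by norm_num, h38, by omega⟩
  by_cases h39 : p < 30643
  · exact ⟨30643, by norm_num, h39, by omega⟩
  by_cases h40 : p < 36767
  · exact ⟨36767, by norm_num, h40, by omega⟩
  by_cases h41 : p < 44119
  · exact ⟨44119, by norm_num, h41, by omega⟩
  by_cases h42 : p < 52937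
  · exact ⟨52937, by norm_num, h42, by omega⟩
  by_cases h43 : p < 63521
  · exact ⟨63521, by norm_num, h43, by omega⟩
  by_cases h44 : p < 76213
  · exact ⟨76213, by norm_num, h44, by omega⟩
  by_cases h45 : p < 91453
  · exact ⟨91453, by norm_num, h45, by omega⟩
  by_cases h46 : p < 109741
  · exact ⟨109741, by norm_num, h46, by omega⟩
  by_cases h47 : p < 131687
  · exact ⟨131687, by norm_num, h47, by omega⟩
  by_cases h48 : p < 158017
  · exact ⟨158017, by norm_num, h48, by omega⟩
  by_cases h49 : p < 189619
  · exact ⟨189619, by norm_num, h49, by omega⟩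
  by_cases h50 : p < 227537
  · exact ⟨227537, by norm_num, h50, by omega⟩
  by_cases h51 : p < 273043
  · exact ⟨273043, by norm_num, h51, by omega⟩
  by_cases h52 : p < 327647
  · exact ⟨327647, by norm_num, h52, by omega⟩
  by_cases h53 : p < 393161
  · exact ⟨393161, by norm_num, h53, by omega⟩
  by_cases h54 : p < 471791
  · exact ⟨471791, by norm_num, h54, by omega⟩
  by_cases h55 : p < 566131
  · exact ⟨566131, by norm_num, h55, by omega⟩
  by_cases h56 : p < 679333
  · exact ⟨679333, by norm_num, h56, by omega⟩
  by_cases h57 : p < 815197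
  · exact ⟨815197, by norm_num, h57, by omega⟩
  by_cases h58 : p < 978233
  · exact ⟨978233, by norm_num, h58, by omega⟩
  by_cases h59 : p < 1173853
  · exact ⟨1173853, by norm_num, h59, by omega⟩
  by_cases h60 : p < 1408621
  · exact ⟨1408621, by norm_num, h60, by omega⟩
  by_cases h61 : p < 1690319
  · exact ⟨1690319, by norm_num, h61, by omega⟩
  by_cases h62 : p < 2028373
  · exact ⟨2028373, by norm_num, h62, by omega⟩
  by_cases h63 : p < 2434037
  · exact ⟨2434037, by norm_num, h63, by omega⟩
  by_cases h64 : p < 2920837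
  · exact ⟨2920837, by norm_num, h64, by omega⟩
  by_cases h65 : p < 3504997
  · exact ⟨3504997, by norm_num, h65, by omega⟩
  by_cases h66 : p < 4205989
  · exact ⟨4205989, by norm_num, h66, by omega⟩
  by_cases h67 : p < 5047171
  · exact ⟨5047171, by norm_num, h67, by omega⟩
  by_cases h68 : p < 6056581
  · exact ⟨6056581, by norm_num, h68, by omega⟩
  by_cases h69 : p < 7267889
  · exact ⟨7267889, by norm_num, h69, by omega⟩
  by_cases h70 : p < 8721443
  · exact ⟨8721443, by norm_num, h70, by omega⟩
  by_cases h71 : p < 10465729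
  · exact ⟨10465729, by norm_num, h71, by omega⟩
  by_cases h72 : p < 12558811
  · exact ⟨12558811, by norm_num, h72, by omega⟩
  by_cases h73 : p < 15070529
  · exact ⟨15070529, by norm_num, h73, by omega⟩
  by_cases h74 : p < 18084629
  · exact ⟨18084629, by norm_num, h74, by omega⟩
  by_cases h75 : p < 21701551
  · exact ⟨21701551, by norm_num, h75, by omega⟩
  by_cases h76 : p < 26041859
  · exact ⟨26041859, by norm_num, h76, by omega⟩
  by_cases h77 : p < 31250227
  · exact ⟨31250227, by norm_num, h77, by omega⟩
  by_cases h78 : p < 37500271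
  · exact ⟨37500271, by norm_num, h78, by omega⟩
  by_cases h79 : p < 45000311
  · exact ⟨45000311, by norm_num, h79, by omega⟩
  by_cases h80 : p < 54000367
  · exact ⟨54000367, by norm_num, h80, by omega⟩
  by_cases h81 : p < 64800433
  · exact ⟨64800433, by norm_num, h81, by omega⟩
  by_cases h82 : p < 77760503
  · exact ⟨77760503, by norm_num, h82, by omega⟩
  by_cases h83 : p < 93312581
  · exact ⟨93312581, by norm_num, h83, by omega⟩
  by_cases h84 : p < 111975091
  · exact ⟨111975091, by norm_num, h84, by omega⟩
  exact wr_large p (by omega)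

lemma wr_gcd (m : ℕ) (hm : 1 ≤ m) : Nat.gcd (tOf m) m = 1 := by
  have g1 := Nat.gcd_dvd_left (tOf m) m
  have g2 := Nat.gcd_dvd_right (tOf m) m
  generalize Nat.gcd (tOf m) m = g at *
  have key : ∀ c, 2 * tOf m = m + c → g ∣ c := by
    intro c hc
    have h : g ∣ m + c := hc ▸ Dvd.dvd.mul_left g1 2
    exact (Nat.dvd_add_right g2).1 h
  have odd : tOf m % 2 = 1 → g ∣ 4 → g = 1 := by
    intro ho h4
    have hg : g ≤ 4 := Nat.le_of_dvd (by norm_num) h4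
    obtain ⟨a, ha⟩ := g1
    have hg2 : g % 2 = 1 := by
      rw [ha, Nat.mul_mod] at ho
      rcases Nat.mod_two_eq_zero_or_one g with h | h
      · simp [h] at ho
      · exact h
    interval_cases g <;> omega
  by_cases h1 : m % 2 = 1
  · have : tOf m = (m + 1) / 2 := by simp [tOf, h1]
    exact Nat.dvd_one.1 (key 1 (by omega))
  · by_cases h2 : m % 4 = 2
    · have : tOf m = m / 2 + 2 := by simp [tOf, h1, h2]
      exact odd (by omega) (key 4 (by omega))
    · have : tOf m = m / 2 + 1 := by simp [tOf, h1, h2]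
      exact odd (by omega) ((key 2 (by omega)).trans (by norm_num))

/-- Let `p < q` be consecutive primes with `q > 37` and `k` an even integer with
`p < k < q`. With `d = gcd(q − 1, k − 2)`, `m = (q − 1)/d` and `t = tOf m`:
`m ≥ 7`, `gcd(t, m) = 1`, and `d·t + 2 < p` and `q + 1 − d·t < p`; in particular
both values are smaller than `k`. -/
theorem weight_reduction_step (p q k : ℕ) (hpq : ConsecutivePrimes p q)
    (hq : q > 37) (hk : Even k) (hpk : p < k) (hkq : k < q) :
    let d := Nat.gcd (q - 1) (k - 2)
    let m := (q - 1) / d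
    let t := tOf m
    7 ≤ m ∧ Nat.gcd t m = 1 ∧
      d * t + 2 < p ∧ q + 1 - d * t < p ∧
      d * t + 2 < k ∧ q + 1 - d * t < k := by
  intro d m t
  obtain ⟨_, hqp, hlt, hmin⟩ := hpq
  have hp37 : 37 ≤ p := by
    by_contra! h
    have := hmin 37 (by norm_num) h
    omega
  obtain ⟨r, hr, hr1, hr2⟩ := wr_gap p hp37
  have hqr := hmin r hr hr1
  have hd1 : d ∣ q - 1 := Nat.gcd_dvd_left _ _
  have hd2 : d ∣ k - 2 := Nat.gcd_dvd_right _ _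
  have hd3 : d ∣ (q - 1) - (k - 2) := Nat.dvd_sub hd1 hd2
  have hdle : d ≤ q - p := (Nat.le_of_dvd (by omega) hd3).trans (by omega)
  have hdm : d * m = q - 1 := Nat.mul_div_cancel' hd1
  have hm7 : 7 ≤ m := by
    by_contra! h
    have : d * m ≤ d * 6 := Nat.mul_le_mul_left d (by omega)
    omega
  have hg : Nat.gcd t m = 1 := wr_gcd m (by omega)
  have hlo : m ≤ 2 * t := by
    show m ≤ 2 * tOf m
    unfold tOf; split_ifs <;> omega
  have hup : 10 * t ≤ 7 * m := by
    show 10 * tOf m ≤ 7 * m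
    unfold tOf; split_ifs <;> omega
  have e1 : d * m ≤ 2 * (d * t) := by nlinarith
  have e2 : 10 * (d * t) ≤ 7 * (d * m) := by nlinarith
  rw [hdm] at e1 e2
  refine ⟨hm7, hg, ?_, ?_, ?_, ?_⟩ <;> omega
end
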